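/- arXiv:1107.4142 — 2 statements merged into one kernel-verified Lean document; each statement's English description precedes it below -/
import Mathlib

section
/- Under assumptions (A1)–(A3), suppose the McKean–Vlasov equation μ̇(t) = A_{μ(t)}^⊤ μ(t) has a unique globally asymptotically stable equilibrium ξ_0 ∈ M_1(Z). Let s : M_1(Z) → [0,∞) be lower semicontinuous, satisfy the dynamic programming equation, and attain the value 0 at some point. Then s is uniquely determined: for every ξ ∈ M_1(Z), s(ξ) = inf ∫_0^∞ Σ_{(i,j)∈E} μ̂(t)(i) λ_{i,j}(μ̂(t)) τ*( l̂_{i,j}(t)/λ_{i,j}(μ̂(t)) − 1 ) dt, the infimum being over all pairs (μ̂, L̂) where L̂ is a time-varying rate matrix and μ̂ : [0,∞) → M_1(Z) is absolutely continuous with μ̂̇(t) = −L̂(t)^⊤ μ̂(t) a.e., μ̂(0) = ξ, μ̂(t) ∈ M_1(Z) for all t ≥ 0, and lim_{t→∞} μ̂(t) = ξ_0. -/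
open MeasureTheory Set ENNReal Filter

noncomputable section

/-- The Legendre conjugate `τ*(u) = (u+1)·log(u+1) − u`.  Since `Real.log 0 = 0`
in Mathlib, this gives `τ*(-1) = 1`, matching the convention of the paper; the
value for `u < -1` is irrelevant since all arguments below are `≥ -1`. -/
def tauStar (u : ℝ) : ℝ := (u + 1) * Real.log (u + 1) - u

/-- The mean field model: state space `Fin r`, directed edge set `E` without
self-loops, and transition rate functions `lam i j`, together with assumptions
(A1) (irreducibility), (A2) (Lipschitz rates) and (A3) (rates on edges bounded
below by `c > 0`); `Cb` is the upper bound on the rates (a consequence of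
(A2) and compactness of the simplex). -/
structure MeanFieldModel (r : ℕ) where
  E : Finset (Fin r × Fin r)
  no_diag : ∀ i : Fin r, (i, i) ∉ E
  /-- (A1): the directed graph `(Z, E)` is irreducible. -/
  irreducible : ∀ i j : Fin r, Relation.ReflTransGen (fun a b => (a, b) ∈ E) i j
  lam : Fin r → Fin r → (Fin r → ℝ) → ℝ
  /-- (A2): each rate function is Lipschitz on the simplex. -/
  lam_lipschitz : ∀ p ∈ E, ∃ K : NNReal, LipschitzOnWith K (lam p.1 p.2) (stdSimplex ℝ (Fin r))
  c : ℝ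
  c_pos : 0 < c
  /-- (A3): rates of admissible jumps are uniformly bounded away from zero. -/
  lam_lower : ∀ p ∈ E, ∀ μ ∈ stdSimplex ℝ (Fin r), c ≤ lam p.1 p.2 μ
  /-- rates vanish off the edge set -/
  lam_off : ∀ i j : Fin r, i ≠ j → (i, j) ∉ E → ∀ μ : Fin r → ℝ, lam i j μ = 0
  /-- diagonal convention `λ_{i,i} = −Σ_{j≠i} λ_{i,j}` -/
  lam_diag : ∀ i : Fin r, ∀ μ : Fin r → ℝ,
    lam i i μ = -∑ j ∈ Finset.univ.filter (fun j => j ≠ i), lam i j μ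
  Cb : ℝ
  /-- upper bound on the rates -/
  lam_upper : ∀ p ∈ E, ∀ μ ∈ stdSimplex ℝ (Fin r), lam p.1 p.2 μ ≤ Cb

variable {r : ℕ}

/-- A time-varying rate matrix `L(t)` adapted to the model: measurable entries,
nonnegative off-diagonal entries, entries vanishing off the edge set, and the
diagonal convention `l_{i,i}(t) = −Σ_{j≠i} l_{i,j}(t)`. -/
def IsRateMatrix (M : MeanFieldModel r) (L : ℝ → Fin r → Fin r → ℝ) : Prop :=
  (∀ i j : Fin r, Measurable fun t => L t i j) ∧
  (∀ t : ℝ, ∀ i j : Fin r, i ≠ j → 0 ≤ L t i j) ∧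
  (∀ t : ℝ, ∀ i j : Fin r, i ≠ j → (i, j) ∉ M.E → L t i j = 0) ∧
  (∀ t : ℝ, ∀ i : Fin r,
    L t i i = -∑ j ∈ Finset.univ.filter (fun j => j ≠ i), L t i j)

/-- `μ` is absolutely continuous on `[0,T]` with `μ̇(t) = L(t)ᵀ μ(t)` a.e.,
expressed in integral form:  `μ(t) = μ(0) + ∫_0^t L(s)ᵀ μ(s) ds`. -/
def SolvesODE (L : ℝ → Fin r → Fin r → ℝ) (μ : ℝ → Fin r → ℝ) (T : ℝ) : Prop :=
  (∀ i : Fin r, IntegrableOn (fun t => ∑ j, L t j i * μ t j) (Icc 0 T)) ∧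
  ∀ t ∈ Icc (0 : ℝ) T, ∀ i : Fin r,
    μ t i = μ 0 i + ∫ s in Ioc (0 : ℝ) t, ∑ j, L s j i * μ s j

/-- `μ` is absolutely continuous on `[0,∞)` with `μ̇(t) = −L(t)ᵀ μ(t)` a.e.
(reversed-time dynamics), in integral form. -/
def SolvesReversedODE (L : ℝ → Fin r → Fin r → ℝ) (μ : ℝ → Fin r → ℝ) : Prop :=
  (∀ T : ℝ, 0 < T → ∀ i : Fin r,
    IntegrableOn (fun t => ∑ j, L t j i * μ t j) (Icc 0 T)) ∧
  ∀ t : ℝ, 0 ≤ t → ∀ i : Fin r,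
    μ t i = μ 0 i - ∫ s in Ioc (0 : ℝ) t, ∑ j, L s j i * μ s j

/-- The running cost
`I_{[0,T]}(μ, L) = ∫_0^T Σ_{(i,j)∈E} μ(t)(i) λ_{i,j}(μ(t)) τ*( l_{i,j}(t)/λ_{i,j}(μ(t)) − 1 ) dt`. -/
def runningCost (M : MeanFieldModel r) (μ : ℝ → Fin r → ℝ)
    (L : ℝ → Fin r → Fin r → ℝ) (T : ℝ) : ℝ≥0∞ :=
  ∫⁻ t in Ioc (0 : ℝ) T, ENNReal.ofReal (∑ p ∈ M.E,
    μ t p.1 * M.lam p.1 p.2 (μ t) * tauStar (L t p.1 p.2 / M.lam p.1 p.2 (μ t) - 1))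

/-- The infinite-horizon running cost on `[0, ∞)`. -/
def runningCostInf (M : MeanFieldModel r) (μ : ℝ → Fin r → ℝ)
    (L : ℝ → Fin r → Fin r → ℝ) : ℝ≥0∞ :=
  ∫⁻ t in Ioi (0 : ℝ), ENNReal.ofReal (∑ p ∈ M.E,
    μ t p.1 * M.lam p.1 p.2 (μ t) * tauStar (L t p.1 p.2 / M.lam p.1 p.2 (μ t) - 1))

/-- `S_{[0,T]}(μ | ν)`: the infimum of the running cost over all time-varying
rate matrices `L` with `μ̇ = Lᵀ μ` a.e., provided `μ(0) = ν`, `μ` is absolutely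
continuous and takes values in `M₁(Z)`; `+∞` otherwise (the infimum over an
empty family being `⊤`). -/
def SPath (M : MeanFieldModel r) (T : ℝ) (ν : Fin r → ℝ) (μ : ℝ → Fin r → ℝ) : ℝ≥0∞ :=
  ⨅ (L : ℝ → Fin r → Fin r → ℝ)
    (_ : IsRateMatrix M L ∧ SolvesODE L μ T ∧ μ 0 = ν ∧
      ∀ t ∈ Icc (0 : ℝ) T, μ t ∈ stdSimplex ℝ (Fin r)),
    runningCost M μ L T

/-- `S_T(ξ | ν) = inf { S_{[0,T]}(μ|ν) : μ(0) = ν, μ(T) = ξ }`. -/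
def SEnd (M : MeanFieldModel r) (T : ℝ) (ν ξ : Fin r → ℝ) : ℝ≥0∞ :=
  ⨅ (μ : ℝ → Fin r → ℝ) (_ : μ 0 = ν ∧ μ T = ξ), SPath M T ν μ

/-- The quasipotential `V(ξ | ν) = inf_{T > 0} S_T(ξ | ν)`. -/
def quasipotential (M : MeanFieldModel r) (ν ξ : Fin r → ℝ) : ℝ≥0∞ :=
  ⨅ (T : ℝ) (_ : 0 < T), SEnd M T ν ξ

/-- Equivalence of points: `ν ∼ ξ` iff `V(ξ|ν) = V(ν|ξ) = 0`. -/
def VEquiv (M : MeanFieldModel r) (ν ξ : Fin r → ℝ) : Prop :=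
  quasipotential M ν ξ = 0 ∧ quasipotential M ξ ν = 0

/-- `s` satisfies the dynamic programming equation
`s(ξ) = inf_{ν ∈ M₁(Z)} [ s(ν) + S_T(ξ|ν) ]` for every `T > 0`. -/
def SatisfiesDPE (M : MeanFieldModel r) (s : (Fin r → ℝ) → ℝ) : Prop :=
  ∀ T : ℝ, 0 < T → ∀ ξ ∈ stdSimplex ℝ (Fin r),
    ENNReal.ofReal (s ξ) =
      ⨅ ν ∈ stdSimplex ℝ (Fin r), (ENNReal.ofReal (s ν) + SEnd M T ν ξ)

/-- A solution of the McKean–Vlasov equation `μ̇(t) = A_{μ(t)}ᵀ μ(t)` on `[0,∞)`,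
as a path in `M₁(Z)`, in integral form. -/
def IsMVSolution (M : MeanFieldModel r) (η : ℝ → Fin r → ℝ) : Prop :=
  (∀ t : ℝ, 0 ≤ t → η t ∈ stdSimplex ℝ (Fin r)) ∧
  (∀ T : ℝ, 0 < T → ∀ i : Fin r,
    IntegrableOn (fun t => ∑ j, M.lam j i (η t) * η t j) (Icc 0 T)) ∧
  ∀ t : ℝ, 0 ≤ t → ∀ i : Fin r,
    η t i = η 0 i + ∫ s in Ioc (0 : ℝ) t, ∑ j, M.lam j i (η s) * η s j

/-- A solution of the time-reversed McKean–Vlasov equation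
`η̇(t) = −A_{η(t)}ᵀ η(t)` on `[0,∞)`, in integral form. -/
def IsReversedMVSolution (M : MeanFieldModel r) (η : ℝ → Fin r → ℝ) : Prop :=
  (∀ T : ℝ, 0 < T → ∀ i : Fin r,
    IntegrableOn (fun t => ∑ j, M.lam j i (η t) * η t j) (Icc 0 T)) ∧
  ∀ t : ℝ, 0 ≤ t → ∀ i : Fin r,
    η t i = η 0 i - ∫ s in Ioc (0 : ℝ) t, ∑ j, M.lam j i (η s) * η s j

/-- `ξ₀` is the unique globally asymptotically stable equilibrium of the
McKean–Vlasov equation: `A_{ξ₀}ᵀ ξ₀ = 0` and every solution with initial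
condition in `M₁(Z)` converges to `ξ₀`. -/
def IsUniqueGASEquilibrium (M : MeanFieldModel r) (ξ₀ : Fin r → ℝ) : Prop :=
  ξ₀ ∈ stdSimplex ℝ (Fin r) ∧
  (∀ i : Fin r, ∑ j, M.lam j i ξ₀ * ξ₀ j = 0) ∧
  ∀ η : ℝ → Fin r → ℝ, IsMVSolution M η → Tendsto η atTop (nhds ξ₀)

/-- The ω-limit set of a path: `Ω = ∩_{t>0} closure { μ(t') : t' ≥ t }`. -/
def omegaSet (η : ℝ → Fin r → ℝ) : Set (Fin r → ℝ) :=
  ⋂ t ∈ Ioi (0 : ℝ), closure (η '' Ici t)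

/-- Assumption (B): finitely many compact subsets `K 1, …, K l` of `M₁(Z)` such
that any two points of the same `K i` are equivalent, no point of `K i` is
equivalent to a point of `M₁(Z)` outside `K i`, and every ω-limit set of the
McKean–Vlasov equation is contained in some `K i`. -/
def AssumptionB (M : MeanFieldModel r) (l : ℕ) (K : Fin l → Set (Fin r → ℝ)) : Prop :=
  (∀ i, IsCompact (K i)) ∧
  (∀ i, K i ⊆ stdSimplex ℝ (Fin r)) ∧
  (∀ i, ∀ ν ∈ K i, ∀ ξ ∈ K i, VEquiv M ν ξ) ∧
  (∀ i, ∀ ν ∈ K i, ∀ ξ ∈ stdSimplex ℝ (Fin r), ξ ∉ K i → ¬ VEquiv M ν ξ) ∧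
  (∀ η : ℝ → Fin r → ℝ, IsMVSolution M η → ∃ i, omegaSet η ⊆ K i)

/-- `μ` is continuous and piecewise linear on `[0,T]`, with constant velocity on
each linear segment (linear interpolation between the breakpoints). -/
def PiecewiseLinear (μ : ℝ → Fin r → ℝ) (T : ℝ) : Prop :=
  ∃ (n : ℕ) (t : Fin (n + 1) → ℝ), StrictMono t ∧ t 0 = 0 ∧ t (Fin.last n) = T ∧
    ∀ k : Fin n, ∀ u ∈ Icc (t k.castSucc) (t k.succ), ∀ i : Fin r,
      μ u i = μ (t k.castSucc) i +
        (u - t k.castSucc) / (t k.succ - t k.castSucc) *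
          (μ (t k.succ) i - μ (t k.castSucc) i)

end


/-- primitive -/
def Prm (x g : ℝ → ℝ) (T : ℝ) : Prop :=
  IntegrableOn g (Icc 0 T) ∧ ∀ t ∈ Icc (0 : ℝ) T, x t = x 0 + ∫ s in Ioc (0 : ℝ) t, g s

lemma Prm.ii {x g : ℝ → ℝ} {T : ℝ} (h : Prm x g T) {a b : ℝ} (ha : a ∈ Icc 0 T)
    (hb : b ∈ Icc 0 T) : IntervalIntegrable g volume a b := by
  have hT : 0 ≤ T := ha.1.trans ha.2
  have : IntervalIntegrable g volume 0 T := by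
    rw [intervalIntegrable_iff_integrableOn_Icc_of_le hT]; exact h.1
  exact this.mono_set (by
    rw [uIcc_of_le hT]
    exact uIcc_subset_Icc ha hb)

lemma Prm.diff {x g : ℝ → ℝ} {T : ℝ} (h : Prm x g T) {a b : ℝ} (ha : a ∈ Icc 0 T)
    (hb : b ∈ Icc 0 T) : x b = x a + ∫ s in a..b, g s := by
  have hT : 0 ≤ T := ha.1.trans ha.2
  have h0 : (0:ℝ) ∈ Icc 0 T := ⟨le_rfl, hT⟩
  rw [h.2 a ha, h.2 b hb, ← intervalIntegral.integral_of_le ha.1,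
    ← intervalIntegral.integral_of_le hb.1, add_assoc,
    intervalIntegral.integral_add_adjacent_intervals (h.ii h0 ha) (h.ii ha hb)]

lemma Prm.mk' {x g : ℝ → ℝ} {T : ℝ} (hT : 0 ≤ T) (h1 : IntervalIntegrable g volume 0 T)
    (h2 : ∀ t ∈ Icc (0 : ℝ) T, x t = x 0 + ∫ s in (0:ℝ)..t, g s) : Prm x g T := by
  refine ⟨(intervalIntegrable_iff_integrableOn_Icc_of_le hT).1 h1, fun t ht => ?_⟩
  rw [h2 t ht, intervalIntegral.integral_of_le ht.1]

lemma Prm.shift {x g : ℝ → ℝ} {T : ℝ} (h : Prm x g T) {a b : ℝ} (ha : 0 ≤ a) (hab : a ≤ b)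
    (hb : b ≤ T) : Prm (fun t => x (a + t)) (fun t => g (a + t)) (b - a) := by
  have haI : a ∈ Icc 0 T := ⟨ha, hab.trans hb⟩
  have hbI : b ∈ Icc 0 T := ⟨ha.trans hab, hb⟩
  apply Prm.mk' (by linarith)
  · have := (h.ii haI hbI).comp_add_left a
    simpa using this
  · intro t ht
    rw [intervalIntegral.integral_comp_add_left]
    simp only [add_zero]
    exact h.diff haI ⟨by linarith [ht.1], by linarith [ht.2]⟩

lemma Prm.rev {x g : ℝ → ℝ} {T : ℝ} (hT : 0 ≤ T) (h : Prm x g T) :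
    Prm (fun t => x (T - t)) (fun t => - g (T - t)) T := by
  have h0 : (0:ℝ) ∈ Icc 0 T := ⟨le_rfl, hT⟩
  have hTT : T ∈ Icc 0 T := ⟨hT, le_rfl⟩
  apply Prm.mk' hT
  · have := ((h.ii h0 hTT).comp_sub_left T).symm
    simp only [sub_zero, sub_self] at this
    exact this.neg
  · intro t ht
    rw [intervalIntegral.integral_neg, intervalIntegral.integral_comp_sub_left (fun s => g s)]
    simp only [sub_zero]
    have := h.diff (a := T - t) (b := T) ⟨by linarith [ht.2], by linarith [ht.1]⟩ hTT
    linarith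

lemma Prm.glue {x g y k : ℝ → ℝ} {T U : ℝ} (hT : 0 ≤ T) (hU : 0 ≤ U) (h : Prm x g T)
    (h' : Prm y k U) (hxy : x T = y 0) :
    Prm (fun t => if t ≤ T then x t else y (t - T)) (fun t => if t ≤ T then g t else k (t - T))
      (T + U) := by
  have h0 : (0:ℝ) ∈ Icc 0 T := ⟨le_rfl, hT⟩
  have hTT : T ∈ Icc 0 T := ⟨hT, le_rfl⟩
  have h0' : (0:ℝ) ∈ Icc 0 U := ⟨le_rfl, hU⟩
  have hUU : U ∈ Icc 0 U := ⟨hU, le_rfl⟩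
  set q : ℝ → ℝ := fun t => if t ≤ T then g t else k (t - T) with hq
  have e1 : ∀ t ∈ Icc 0 T, EqOn g q (uIoc 0 t) := by
    intro t ht s hs
    rw [uIoc_of_le ht.1] at hs
    simp [hq, hs.2.trans ht.2]
  have e2 : ∀ t, T ≤ t → EqOn (fun s => k (s - T)) q (uIoc T t) := by
    intro t ht s hs
    rw [uIoc_of_le ht] at hs
    simp [hq, not_le.2 hs.1]
  have i1 : IntervalIntegrable q volume 0 T := (h.ii h0 hTT).congr (e1 T hTT)
  have i2 : ∀ t, T ≤ t → t ≤ T + U → IntervalIntegrable q volume T t := by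
    intro t ht ht'
    refine IntervalIntegrable.congr (e2 t ht) ?_
    have := (h'.ii h0' (b := t - T) ⟨by linarith, by linarith⟩).comp_sub_right T
    simpa using this
  apply Prm.mk' (by linarith)
  · exact i1.trans (i2 _ (by linarith) le_rfl)
  · intro t ht
    by_cases htT : t ≤ T
    · simp only [htT, hT, if_true]
      rw [h.diff h0 ⟨ht.1, htT⟩]
      congr 1
      exact intervalIntegral.integral_congr_ae (ae_of_all _ (e1 t ⟨ht.1, htT⟩))
    · simp only [htT, hT, if_true, if_false]
      push Not at htT
      rw [h'.diff h0' (b := t - T) ⟨by linarith, by linarith [ht.2]⟩, ← hxy, h.diff h0 hTT,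
        ← intervalIntegral.integral_add_adjacent_intervals i1 (i2 t htT.le ht.2), add_assoc]
      congr 2
      · exact intervalIntegral.integral_congr_ae (ae_of_all _ (e1 T hTT))
      · rw [← intervalIntegral.integral_congr_ae (ae_of_all _ (e2 t htT.le)),
          intervalIntegral.integral_comp_sub_right (fun s => k s)]
        simp

lemma Prm.mono {x g : ℝ → ℝ} {T U : ℝ} (h : Prm x g T) (hU : U ≤ T) : Prm x g U :=
  ⟨h.1.mono_set (Icc_subset_Icc le_rfl hU), fun t ht => h.2 t ⟨ht.1, ht.2.trans hU⟩⟩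

lemma Prm.cont {x g : ℝ → ℝ} {T : ℝ} (h : Prm x g T) : ContinuousOn x (Icc 0 T) := by
  have h1 : ContinuousOn (fun t => x 0 + ∫ s in Ioc (0 : ℝ) t, g s) (Icc 0 T) :=
    continuousOn_const.add (intervalIntegral.continuousOn_primitive h.1)
  exact h1.congr h.2

lemma tauStar_ge {a u : ℝ} (ha : 0 < a) (ha1 : a ≤ 1) (hu : -1 ≤ u) :
    |u| ≤ tauStar u / a + a := by
  have key : ∀ b : ℝ, |b| ≤ 1 → b * u ≤ tauStar u + b ^ 2 := by
    intro b hb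
    have hexp : Real.exp b ≤ 1 + b + b ^ 2 := by
      have := Real.abs_exp_sub_one_sub_id_le hb
      have := (abs_le.1 this).2
      linarith
    unfold tauStar
    rcases eq_or_lt_of_le hu with h | h
    · subst h
      have := Real.add_one_le_exp b
      norm_num
      nlinarith
    · set y := u + 1 with hy
      have hy0 : 0 < y := by linarith
      have h1 := Real.add_one_le_exp (b - Real.log y)
      rw [Real.exp_sub, Real.exp_log hy0, le_div_iff₀ hy0] at h1
      have : u = y - 1 := by linarith
      rw [this]
      nlinarith
  have h1 := key a (by rw [abs_of_pos ha]; exact ha1)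
  have h2 := key (-a) (by rw [abs_neg, abs_of_pos ha]; exact ha1)
  have : a * |u| ≤ tauStar u + a ^ 2 := by
    rcases abs_cases u with h | h <;> rw [h.1] <;> nlinarith
  have e : tauStar u / a + a = (tauStar u + a ^ 2) / a := by field_simp
  rw [e, le_div_iff₀ ha]; linarith

lemma tauStar_nonneg {u : ℝ} (hu : -1 ≤ u) : 0 ≤ tauStar u := by
  unfold tauStar
  rcases eq_or_lt_of_le hu with h | h
  · subst h; norm_num
  · have hy0 : 0 < u + 1 := by linarith
    have h1 := Real.one_sub_inv_le_log_of_pos hy0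
    have : (u + 1) * (1 - (u + 1)⁻¹) = u := by field_simp; ring
    nlinarith

lemma tauStar_le {u : ℝ} (hu : -1 ≤ u) : tauStar u ≤ u ^ 2 := by
  unfold tauStar
  rcases eq_or_lt_of_le hu with h | h
  · subst h; norm_num
  · have hy0 : 0 < u + 1 := by linarith
    have h1 := Real.log_le_sub_one_of_pos hy0
    nlinarith

noncomputable def gcost {r : ℕ} (M : MeanFieldModel r) (m : Fin r → ℝ)
    (l : Fin r → Fin r → ℝ) : ℝ≥0∞ :=
  ENNReal.ofReal (∑ p ∈ M.E, m p.1 * M.lam p.1 p.2 m * tauStar (l p.1 p.2 / M.lam p.1 p.2 m - 1))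

def IsPath {r : ℕ} (M : MeanFieldModel r) (μ : ℝ → Fin r → ℝ) (L : ℝ → Fin r → Fin r → ℝ)
    (T : ℝ) : Prop :=
  IsRateMatrix M L ∧ (∀ i, Prm (fun t => μ t i) (fun t => ∑ j, L t j i * μ t j) T) ∧
    ∀ t ∈ Icc (0 : ℝ) T, μ t ∈ stdSimplex ℝ (Fin r)

lemma solves_iff {r : ℕ} (μ : ℝ → Fin r → ℝ) (L : ℝ → Fin r → Fin r → ℝ) (T : ℝ) :
    SolvesODE L μ T ↔ ∀ i, Prm (fun t => μ t i) (fun t => ∑ j, L t j i * μ t j) T := by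
  constructor
  · intro h i
    exact ⟨h.1 i, fun t ht => h.2 t ht i⟩
  · intro h
    exact ⟨fun i => (h i).1, fun t ht i => (h i).2 t ht⟩

lemma runningCost_eq {r : ℕ} (M : MeanFieldModel r) (μ : ℝ → Fin r → ℝ)
    (L : ℝ → Fin r → Fin r → ℝ) (T : ℝ) :
    runningCost M μ L T = ∫⁻ t in Ioc (0 : ℝ) T, gcost M (μ t) (L t) := rfl

lemma SEnd_le {r : ℕ} {M : MeanFieldModel r} {μ : ℝ → Fin r → ℝ}
    {L : ℝ → Fin r → Fin r → ℝ} {T : ℝ} (h : IsPath M μ L T) {ν ξ : Fin r → ℝ} (h0 : μ 0 = ν)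
    (hT : μ T = ξ) : SEnd M T ν ξ ≤ runningCost M μ L T := by
  unfold SEnd SPath
  exact (iInf₂_le μ ⟨h0, hT⟩).trans
    (iInf₂_le L ⟨h.1, (solves_iff _ _ _).2 h.2.1, h0, h.2.2⟩)

lemma le_SEnd {r : ℕ} {M : MeanFieldModel r} {T : ℝ} {ν ξ : Fin r → ℝ} {x c : ℝ≥0∞}
    (h : ∀ μ L, IsPath M μ L T → μ 0 = ν → μ T = ξ → x ≤ runningCost M μ L T + c) :
    x ≤ SEnd M T ν ξ + c := by
  simp only [SEnd, SPath, ENNReal.iInf_add]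
  refine le_iInf fun μ => le_iInf fun h1 => le_iInf fun L => le_iInf fun h2 => ?_
  exact h μ L ⟨h2.1, (solves_iff _ _ _).1 h2.2.1, h2.2.2.2⟩ h1.1 h1.2

lemma exists_of_SEnd_lt {r : ℕ} {M : MeanFieldModel r} {T : ℝ} {ν ξ : Fin r → ℝ} {x : ℝ≥0∞}
    (h : SEnd M T ν ξ < x) :
    ∃ μ L, IsPath M μ L T ∧ μ 0 = ν ∧ μ T = ξ ∧ runningCost M μ L T < x := by
  simp only [SEnd, SPath, iInf_lt_iff] at h
  obtain ⟨μ, h1, L, h2, h3⟩ := h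
  exact ⟨μ, L, ⟨h2.1, (solves_iff _ _ _).1 h2.2.1, h2.2.2.2⟩, h1.1, h1.2, h3⟩

lemma lint_shift (f : ℝ → ℝ≥0∞) (a b : ℝ) :
    ∫⁻ t in Ioc 0 (b - a), f (a + t) = ∫⁻ t in Ioc a b, f t := by
  rw [← (measurePreserving_add_left volume a).setLIntegral_comp_preimage_emb
    (measurableEmbedding_addLeft a) f (Ioc a b)]
  congr 2
  simp

lemma lint_rev (f : ℝ → ℝ≥0∞) (T : ℝ) :
    ∫⁻ t in Ioc 0 T, f (T - t) = ∫⁻ t in Ioc 0 T, f t := by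
  rw [← setLIntegral_congr (Ico_ae_eq_Ioc (a := (0:ℝ)) (b := T)) (f := f)]
  rw [← (Measure.measurePreserving_sub_left volume T).setLIntegral_comp_preimage_emb
    (MeasurableEquiv.subLeft T).measurableEmbedding f (Ico 0 T)]
  congr 2
  ext t
  simp only [mem_Ioc, mem_preimage, mem_Ico]
  constructor <;> rintro ⟨h1, h2⟩ <;> constructor <;> linarith

lemma IsRateMatrix.comp {r : ℕ} {M : MeanFieldModel r} {L : ℝ → Fin r → Fin r → ℝ}
    (h : IsRateMatrix M L) {f : ℝ → ℝ} (hf : Measurable f) : IsRateMatrix M (fun t => L (f t)) :=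
  ⟨fun i j => (h.1 i j).comp hf, fun _ => h.2.1 _, fun _ => h.2.2.1 _, fun _ => h.2.2.2 _⟩

lemma IsRateMatrix.ite {r : ℕ} {M : MeanFieldModel r} {L L' : ℝ → Fin r → Fin r → ℝ}
    (h : IsRateMatrix M L) (h' : IsRateMatrix M L') (T : ℝ) :
    IsRateMatrix M (fun t => if t ≤ T then L t else L' t) := by
  refine ⟨fun i j => ?_, fun t => ?_, fun t => ?_, fun t => ?_⟩
  · have : (fun t => (if t ≤ T then L t else L' t) i j)
      = fun t => if t ≤ T then L t i j else L' t i j := by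
      ext t; split_ifs <;> rfl
    rw [this]
    exact Measurable.ite measurableSet_Iic (h.1 i j) (h'.1 i j)
  all_goals
    dsimp only
    split_ifs
  exacts [h.2.1 t, h'.2.1 t, h.2.2.1 t, h'.2.2.1 t, h.2.2.2 t, h'.2.2.2 t]

lemma IsPath.shift {r : ℕ} {M : MeanFieldModel r} {μ : ℝ → Fin r → ℝ}
    {L : ℝ → Fin r → Fin r → ℝ} {T : ℝ} (h : IsPath M μ L T) {a b : ℝ} (ha : 0 ≤ a) (hab : a ≤ b)
    (hb : b ≤ T) : IsPath M (fun t => μ (a + t)) (fun t => L (a + t)) (b - a) ∧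
      runningCost M (fun t => μ (a + t)) (fun t => L (a + t)) (b - a) ≤ runningCost M μ L T := by
  refine ⟨⟨h.1.comp (measurable_const_add a), fun i => ?_, fun t ht => ?_⟩, ?_⟩
  · exact (h.2.1 i).shift ha hab hb
  · exact h.2.2 _ ⟨by linarith [ht.1], by linarith [ht.2]⟩
  · rw [runningCost_eq, runningCost_eq, lint_shift (fun t => gcost M (μ t) (L t))]
    exact lintegral_mono_set (Ioc_subset_Ioc ha hb)

lemma cost_glue {r : ℕ} (M : MeanFieldModel r) (μ μ' : ℝ → Fin r → ℝ)
    (L L' : ℝ → Fin r → Fin r → ℝ) {T U : ℝ} (hT : 0 ≤ T) (hU : 0 ≤ U) :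
    runningCost M (fun t => if t ≤ T then μ t else μ' (t - T))
      (fun t => if t ≤ T then L t else L' (t - T)) (T + U) =
      runningCost M μ L T + runningCost M μ' L' U := by
  simp only [runningCost_eq]
  rw [← Ioc_union_Ioc_eq_Ioc hT (by linarith : T ≤ T + U),
    lintegral_union measurableSet_Ioc (Ioc_disjoint_Ioc_of_le le_rfl)]
  congr 1
  · refine setLIntegral_congr_fun measurableSet_Ioc fun t ht => ?_
    simp [ht.2]
  · have := lint_shift (fun t => gcost M (μ' (t - T)) (L' (t - T))) T (T + U)
    simp only [add_sub_cancel_left] at this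
    rw [this]
    refine setLIntegral_congr_fun measurableSet_Ioc fun t ht => ?_
    simp [not_le.2 ht.1]

lemma IsPath.glue {r : ℕ} {M : MeanFieldModel r} {μ μ' : ℝ → Fin r → ℝ}
    {L L' : ℝ → Fin r → Fin r → ℝ} {T U : ℝ} (hT : 0 ≤ T) (hU : 0 ≤ U) (h : IsPath M μ L T)
    (h' : IsPath M μ' L' U) (hxy : μ T = μ' 0) :
    IsPath M (fun t => if t ≤ T then μ t else μ' (t - T))
      (fun t => if t ≤ T then L t else L' (t - T)) (T + U) := by
  refine ⟨h.1.ite (h'.1.comp (measurable_id.sub_const T)) T, fun i => ?_, fun t ht => ?_⟩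
  · have := (h.2.1 i).glue hT hU (h'.2.1 i) (congrFun hxy i)
    convert this using 1
    · ext t; dsimp only; split_ifs <;> rfl
    · ext t; dsimp only; split_ifs <;> rfl
  · dsimp only
    split_ifs with h1
    · exact h.2.2 t ⟨ht.1, h1⟩
    · exact h'.2.2 _ ⟨by linarith, by linarith [ht.2]⟩

lemma quasi_triangle {r : ℕ} {M : MeanFieldModel r} {μ : ℝ → Fin r → ℝ}
    {L : ℝ → Fin r → Fin r → ℝ} {T : ℝ} (hT : 0 ≤ T) (h : IsPath M μ L T) (ν : Fin r → ℝ) :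
    quasipotential M ν (μ T) ≤ quasipotential M ν (μ 0) + runningCost M μ L T := by
  conv_rhs => rw [quasipotential]
  simp only [ENNReal.iInf_add]
  refine le_iInf fun U => le_iInf fun hU => ?_
  refine le_SEnd fun μ' L' hp h0 hU' => ?_
  rw [← cost_glue M μ' μ L' L hU.le hT]
  unfold quasipotential
  refine (iInf₂_le (U + T) (by linarith)).trans ?_
  apply SEnd_le (hp.glue hU.le hT h hU')
  · simp [hU.le, h0]
  · by_cases hT0 : T = 0
    · subst hT0; simp [hU']
    · have : 0 < T := lt_of_le_of_ne hT (Ne.symm hT0)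
      simp [this]

lemma rates_at {r : ℕ} (M : MeanFieldModel r) {m : Fin r → ℝ} (hm : m ∈ stdSimplex ℝ (Fin r)) :
    IsRateMatrix M (fun _ i j => M.lam i j m) := by
  refine ⟨fun i j => measurable_const, fun t i j hij => ?_, fun t i j hij hE => M.lam_off i j hij hE m,
    fun t i => M.lam_diag i m⟩
  by_cases hE : (i, j) ∈ M.E
  · exact M.c_pos.le.trans (M.lam_lower _ hE m hm)
  · exact (M.lam_off i j hij hE m).ge

lemma gcost_self {r : ℕ} (M : MeanFieldModel r) {m : Fin r → ℝ} (hm : m ∈ stdSimplex ℝ (Fin r)) :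
    gcost M m (fun i j => M.lam i j m) = 0 := by
  unfold gcost
  rw [Finset.sum_eq_zero, ENNReal.ofReal_zero]
  intro p hp
  have := M.c_pos.trans_le (M.lam_lower _ hp m hm)
  rw [div_self this.ne']
  simp [tauStar]

/-- C5 -/
lemma rhs_le {r : ℕ} {M : MeanFieldModel r} {ξ₀ ξ : Fin r → ℝ} (hξ₀ : ξ₀ ∈ stdSimplex ℝ (Fin r))
    (heq : ∀ i : Fin r, ∑ j, M.lam j i ξ₀ * ξ₀ j = 0) :
    (⨅ (μ : ℝ → Fin r → ℝ) (L : ℝ → Fin r → Fin r → ℝ)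
          (_ : IsRateMatrix M L ∧ SolvesReversedODE L μ ∧ μ 0 = ξ ∧
            (∀ t : ℝ, 0 ≤ t → μ t ∈ stdSimplex ℝ (Fin r)) ∧
            Tendsto μ atTop (nhds ξ₀)),
          runningCostInf M μ L) ≤ quasipotential M ξ₀ ξ := by
  unfold quasipotential
  refine le_iInf fun T => le_iInf fun hT => ?_
  rw [← add_zero (SEnd M T ξ₀ ξ)]
  refine le_SEnd fun μ L hp h0 hT' => ?_
  rw [add_zero]
  refine (iInf_le _ (fun t => if t ≤ T then μ (T - t) else ξ₀)).trans ?_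
  refine (iInf_le _ (fun t => if t ≤ T then L (T - t) else fun i j => M.lam i j ξ₀)).trans ?_
  refine (iInf_le _ ⟨?_, ?_, ?_, ?_, ?_⟩).trans ?_
  · change ∫⁻ t in Ioi (0:ℝ), gcost M _ _ ≤ ∫⁻ t in Ioc (0 : ℝ) T, gcost M (μ t) (L t)
    rw [← Ioc_union_Ioi_eq_Ioi hT.le,
      lintegral_union measurableSet_Ioi
        (disjoint_left.2 fun x hx hx' => not_lt.2 hx.2 hx')]
    rw [← lint_rev (fun t => gcost M (μ t) (L t))]
    have e2 : ∫⁻ t in Ioi T, gcost M (if t ≤ T then μ (T - t) else ξ₀)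
        (if t ≤ T then L (T - t) else fun i j => M.lam i j ξ₀) = 0 := by
      rw [setLIntegral_congr_fun (g := fun _ => 0) measurableSet_Ioi]
      · simp
      · intro t ht
        have : ¬ t ≤ T := not_le.2 ht
        simp only [this, if_false]
        exact gcost_self M hξ₀
    rw [e2, add_zero]
    refine le_of_eq (setLIntegral_congr_fun measurableSet_Ioc fun t ht => ?_)
    simp [ht.2]
  · exact (hp.1.comp (measurable_const.sub measurable_id)).ite (rates_at M hξ₀) T
  · have key : ∀ U, 0 ≤ U → ∀ i, Prm (fun t => (if t ≤ T then μ (T - t) else ξ₀) i)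
      (fun t => - ∑ j, (if t ≤ T then L (T - t) else fun i j => M.lam i j ξ₀) j i *
        (if t ≤ T then μ (T - t) else ξ₀) j) (T + U) := by
      intro U hU i
      have hc : Prm (fun _ => ξ₀ i) (fun _ => 0) U := Prm.mk' hU (by simp) (by simp)
      have := ((hp.2.1 i).rev hT.le).glue hT.le hU hc (by simp [h0])
      convert this using 1
      · ext t; split_ifs <;> rfl
      · ext t
        split_ifs
        · rfl
        · rw [heq i, neg_zero]
    constructor
    · intro U hU i
      have := ((key U hU.le i).mono (by linarith : U ≤ T + U)).1.neg
      refine this.congr_fun (fun t _ => ?_) measurableSet_Icc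
      simp
    · intro t ht i
      have := (key t ht i).2 t ⟨ht, by linarith⟩
      rw [integral_neg] at this
      exact this.trans (sub_eq_add_neg _ _).symm
  · simp [hT.le, hT']
  · intro t ht
    dsimp only
    split_ifs with h1
    · exact hp.2.2 _ ⟨by linarith, by linarith⟩
    · exact hξ₀
  · apply tendsto_const_nhds.congr'
    filter_upwards [eventually_gt_atTop T] with t ht
    simp [not_le.2 ht]

/-- C6 -/
lemma SEnd_le_rev {r : ℕ} {M : MeanFieldModel r} {μ : ℝ → Fin r → ℝ}
    {L : ℝ → Fin r → Fin r → ℝ} (hL : IsRateMatrix M L) (hs : SolvesReversedODE L μ)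
    (hm : ∀ t : ℝ, 0 ≤ t → μ t ∈ stdSimplex ℝ (Fin r)) {T : ℝ} (hT : 0 < T) :
    SEnd M T (μ T) (μ 0) ≤ runningCostInf M μ L := by
  have hP : ∀ i, Prm (fun t => μ t i) (fun t => - ∑ j, L t j i * μ t j) T := fun i =>
    ⟨(hs.1 T hT i).neg, fun t ht => by rw [integral_neg, ← sub_eq_add_neg]; exact hs.2 t ht.1 i⟩
  have hp : IsPath M (fun t => μ (T - t)) (fun t => L (T - t)) T := by
    refine ⟨hL.comp (measurable_const.sub measurable_id), fun i => ?_, fun t ht => ?_⟩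
    · have := (hP i).rev hT.le
      simpa using this
    · exact hm _ (by linarith [ht.2])
  refine (SEnd_le hp (by simp) (by simp)).trans ?_
  rw [runningCost_eq, lint_rev (fun t => gcost M (μ t) (L t))]
  exact lintegral_mono_set Ioc_subset_Ioi_self

def inc {r : ℕ} (p : Fin r × Fin r) (k : Fin r) : ℝ :=
  (if p.2 = k then 1 else 0) - (if p.1 = k then 1 else 0)

lemma inc_abs {r : ℕ} (p : Fin r × Fin r) (k : Fin r) : |inc p k| ≤ 1 := by
  unfold inc; split_ifs <;> norm_num

lemma div_form {r : ℕ} (M : MeanFieldModel r) (Q : Fin r → Fin r → ℝ) (m : Fin r → ℝ)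
    (hoff : ∀ i j : Fin r, i ≠ j → (i, j) ∉ M.E → Q i j = 0)
    (hdiag : ∀ i : Fin r, Q i i = -∑ j ∈ Finset.univ.filter (fun j => j ≠ i), Q i j) (k : Fin r) :
    ∑ j, Q j k * m j = ∑ p ∈ M.E, inc p k * (Q p.1 p.2 * m p.1) := by
  have h1 : ∑ p ∈ M.E, inc p k * (Q p.1 p.2 * m p.1)
      = ∑ p : Fin r × Fin r, inc p k * (Q p.1 p.2 * m p.1) := by
    apply Finset.sum_subset (Finset.subset_univ _)
    rintro ⟨a, b⟩ _ hp
    by_cases hab : a = b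
    · subst hab; simp [inc]
    · rw [hoff a b hab hp]; simp
  have h2 : ∑ b, Q k b = 0 := by
    rw [← Finset.sum_filter_add_sum_filter_not Finset.univ (fun j => j ≠ k)]
    have := hdiag k
    have e : Finset.univ.filter (fun j => ¬ j ≠ k) = {k} := by ext; simp
    rw [e, Finset.sum_singleton]; linarith
  rw [h1, Fintype.sum_prod_type]
  have h3 : ∀ a b, inc (a, b) k * (Q a b * m a) =
      (if b = k then Q a b * m a else 0) - (if a = k then Q a b * m a else 0) := by
    intro a b; unfold inc; split_ifs <;> simp
  simp only [h3, Finset.sum_sub_distrib, Finset.sum_ite_eq', Finset.mem_univ, if_true]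
  have h4 : ∑ a, ∑ b, (if a = k then Q a b * m a else 0) = 0 := by
    rw [Finset.sum_comm]
    simp only [Finset.sum_ite_eq', Finset.mem_univ, if_true]
    rw [← Finset.sum_mul, h2, zero_mul]
  rw [h4, sub_zero]

def Fv {r : ℕ} (M : MeanFieldModel r) (m : Fin r → ℝ) (k : Fin r) : ℝ := ∑ j, M.lam j k m * m j

lemma Fv_div {r : ℕ} (M : MeanFieldModel r) (m : Fin r → ℝ) (k : Fin r) :
    Fv M m k = ∑ p ∈ M.E, inc p k * (M.lam p.1 p.2 m * m p.1) :=
  div_form M (fun i j => M.lam i j m) m (fun i j h h' => M.lam_off i j h h' m)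
    (fun i => M.lam_diag i m) k

lemma lam_abs {r : ℕ} (M : MeanFieldModel r) {m : Fin r → ℝ} (hm : m ∈ stdSimplex ℝ (Fin r))
    {p : Fin r × Fin r} (hp : p ∈ M.E) : |M.lam p.1 p.2 m| ≤ |M.Cb| := by
  have h1 := M.c_pos.trans_le (M.lam_lower p hp m hm)
  rw [abs_of_pos h1]
  exact (M.lam_upper p hp m hm).trans (le_abs_self _)

lemma simplex_abs {r : ℕ} {m : Fin r → ℝ} (hm : m ∈ stdSimplex ℝ (Fin r)) (i : Fin r) :
    |m i| ≤ 1 := by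
  rw [abs_of_nonneg (hm.1 i), ← hm.2]
  exact Finset.single_le_sum (fun j _ => hm.1 j) (Finset.mem_univ i)

lemma Fv_lip {r : ℕ} (M : MeanFieldModel r) : ∃ K : ℝ, 0 ≤ K ∧ ∀ m ∈ stdSimplex ℝ (Fin r),
    ∀ m' ∈ stdSimplex ℝ (Fin r), ∀ k, |Fv M m k - Fv M m' k| ≤ K * ‖m - m'‖ := by
  choose! Kf hKf using M.lam_lipschitz
  refine ⟨∑ p ∈ M.E, ((Kf p : ℝ) + |M.Cb|), Finset.sum_nonneg fun p _ => by positivity, ?_⟩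
  intro m hm m' hm' k
  rw [Fv_div, Fv_div, ← Finset.sum_sub_distrib, Finset.sum_mul]
  refine (Finset.abs_sum_le_sum_abs _ _).trans (Finset.sum_le_sum fun p hp => ?_)
  rw [← mul_sub, abs_mul]
  have e : M.lam p.1 p.2 m * m p.1 - M.lam p.1 p.2 m' * m' p.1 =
      (M.lam p.1 p.2 m - M.lam p.1 p.2 m') * m p.1 + M.lam p.1 p.2 m' * (m p.1 - m' p.1) := by ring
  have h1 : |M.lam p.1 p.2 m - M.lam p.1 p.2 m'| ≤ Kf p * ‖m - m'‖ := by
    have := (hKf p hp).dist_le_mul m hm m' hm'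
    rwa [Real.dist_eq, dist_eq_norm] at this
  have h2 : |m p.1 - m' p.1| ≤ ‖m - m'‖ := norm_le_pi_norm (m - m') p.1
  have h3 := lam_abs M hm' hp
  have h4 := simplex_abs hm p.1
  have h5 : |M.lam p.1 p.2 m * m p.1 - M.lam p.1 p.2 m' * m' p.1| ≤
      (Kf p + |M.Cb|) * ‖m - m'‖ := by
    rw [e]
    refine (abs_add_le _ _).trans ?_
    rw [abs_mul, abs_mul, add_mul]
    have : |M.lam p.1 p.2 m - M.lam p.1 p.2 m'| * |m p.1| ≤ Kf p * ‖m - m'‖ * 1 := by gcongr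
    have : |M.lam p.1 p.2 m'| * |m p.1 - m' p.1| ≤ |M.Cb| * ‖m - m'‖ := by gcongr
    linarith
  calc _ ≤ 1 * |M.lam p.1 p.2 m * m p.1 - M.lam p.1 p.2 m' * m' p.1| := by
        gcongr; exact inc_abs _ _
    _ ≤ _ := by rw [one_mul]; exact h5

lemma flow_exists {r : ℕ} (M : MeanFieldModel r) (i j : Fin r) : ∃ θ : Fin r × Fin r → ℝ,
    ∀ k, ∑ p ∈ M.E, inc p k * θ p = (if j = k then 1 else 0) - (if i = k then 1 else 0) := by
  have := M.irreducible i j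
  induction this with
  | refl => exact ⟨fun _ => 0, by simp⟩
  | @tail b d _ hbd ih =>
    obtain ⟨θ, hθ⟩ := ih
    refine ⟨fun p => θ p + if p = (b, d) then 1 else 0, fun k => ?_⟩
    simp only [mul_add, Finset.sum_add_distrib, hθ k, mul_ite, mul_one, mul_zero,
      Finset.sum_ite_eq', hbd, if_true]
    unfold inc
    ring

lemma right_inv {r : ℕ} (hr : 0 < r) (M : MeanFieldModel r) :
    ∃ θ : Fin r → Fin r × Fin r → ℝ, ∀ g : Fin r → ℝ, ∑ i, g i = 0 → ∀ k,
      ∑ p ∈ M.E, inc p k * (∑ i, g i * θ i p) = g k := by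
  choose θ hθ using flow_exists M ⟨0, hr⟩
  refine ⟨θ, fun g hg k => ?_⟩
  simp only [Finset.mul_sum]
  rw [Finset.sum_comm]
  have : ∀ i, ∑ p ∈ M.E, inc p k * (g i * θ i p) =
      g i * ((if i = k then 1 else 0) - (if (⟨0, hr⟩ : Fin r) = k then 1 else 0)) := by
    intro i
    rw [← hθ i k, Finset.mul_sum]
    exact Finset.sum_congr rfl fun p _ => by ring
  simp only [this, mul_sub, Finset.sum_sub_distrib, ← Finset.sum_mul, hg]
  simp

lemma equil_pos {r : ℕ} {M : MeanFieldModel r} {ξ₀ : Fin r → ℝ}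
    (hξ₀ : ξ₀ ∈ stdSimplex ℝ (Fin r)) (heq : ∀ i : Fin r, ∑ j, M.lam j i ξ₀ * ξ₀ j = 0)
    (i : Fin r) : 0 < ξ₀ i := by
  by_contra hi
  have hi0 : ξ₀ i = 0 := le_antisymm (not_lt.1 hi) (hξ₀.1 i)
  have step : ∀ a b, (a, b) ∈ M.E → ξ₀ b = 0 → ξ₀ a = 0 := by
    intro a b hab hb
    have hnn : ∀ j ∈ Finset.univ, 0 ≤ M.lam j b ξ₀ * ξ₀ j := by
      intro j _
      by_cases hjb : j = b
      · subst hjb; simp [hb]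
      · exact mul_nonneg ((rates_at M hξ₀).2.1 0 j b hjb) (hξ₀.1 j)
    have := (Finset.sum_eq_zero_iff_of_nonneg hnn).1 (heq b) a (Finset.mem_univ a)
    have hpos := M.c_pos.trans_le (M.lam_lower _ hab ξ₀ hξ₀)
    exact (mul_eq_zero.1 this).resolve_left hpos.ne'
  have all : ∀ j, ξ₀ j = 0 := by
    intro j
    have := M.irreducible j i
    induction this using Relation.ReflTransGen.head_induction_on with
    | refl => exact hi0
    | head hab _ ih => exact step _ _ hab ih
  have := hξ₀.2
  simp [all] at this

lemma gcost_le {r : ℕ} (M : MeanFieldModel r) {m : Fin r → ℝ} (hm : m ∈ stdSimplex ℝ (Fin r))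
    (l : Fin r → Fin r → ℝ) {a : ℝ} (ha : a ≤ 1)
    (hl : ∀ p ∈ M.E, |l p.1 p.2 / M.lam p.1 p.2 m - 1| ≤ a) :
    gcost M m l ≤ ENNReal.ofReal (M.E.card * |M.Cb| * a) := by
  unfold gcost
  apply ENNReal.ofReal_le_ofReal
  have : ∀ p ∈ M.E, m p.1 * M.lam p.1 p.2 m * tauStar (l p.1 p.2 / M.lam p.1 p.2 m - 1) ≤
      |M.Cb| * a := by
    intro p hp
    have h0 := hl p hp
    have ha0 : 0 ≤ a := (abs_nonneg _).trans h0
    have h1 := (abs_le.1 h0).1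
    have h2 := tauStar_le (u := l p.1 p.2 / M.lam p.1 p.2 m - 1) (by linarith)
    have h2' := tauStar_nonneg (u := l p.1 p.2 / M.lam p.1 p.2 m - 1) (by linarith)
    have h3 : tauStar (l p.1 p.2 / M.lam p.1 p.2 m - 1) ≤ a := by
      refine h2.trans ?_
      rw [← sq_abs]
      nlinarith [abs_nonneg (l p.1 p.2 / M.lam p.1 p.2 m - 1)]
    have h4 := (le_abs_self _).trans (lam_abs M hm hp)
    have h5 := (le_abs_self _).trans (simplex_abs hm p.1)
    have h6 := M.c_pos.trans_le (M.lam_lower p hp m hm)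
    have h7 := hm.1 p.1
    have : m p.1 * M.lam p.1 p.2 m ≤ 1 * |M.Cb| := by gcongr
    calc _ ≤ (1 * |M.Cb|) * a := by gcongr
      _ = _ := by ring
  calc _ ≤ ∑ p ∈ M.E, |M.Cb| * a := Finset.sum_le_sum this
    _ = _ := by simp; ring

lemma simplex_seg {r : ℕ} {x y : Fin r → ℝ} (hx : x ∈ stdSimplex ℝ (Fin r))
    (hy : y ∈ stdSimplex ℝ (Fin r)) {t : ℝ} (h0 : 0 ≤ t) (h1 : t ≤ 1) :
    (fun i => x i + t * (y i - x i)) ∈ stdSimplex ℝ (Fin r) := by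
  have := (convex_stdSimplex ℝ (Fin r)) hx hy (by linarith : 0 ≤ 1 - t) h0 (by ring)
  convert this using 1
  ext i; simp; ring

lemma lam_contOn {r : ℕ} (M : MeanFieldModel r) {p : Fin r × Fin r} (hp : p ∈ M.E) :
    ContinuousOn (M.lam p.1 p.2) (stdSimplex ℝ (Fin r)) := by
  obtain ⟨K, hK⟩ := M.lam_lipschitz p hp
  exact hK.continuousOn

lemma Fv_contOn {r : ℕ} (M : MeanFieldModel r) (k : Fin r) :
    ContinuousOn (fun m => Fv M m k) (stdSimplex ℝ (Fin r)) := by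
  simp only [Fv_div]
  refine continuousOn_finsetSum _ fun p hp => ?_
  exact continuousOn_const.mul ((lam_contOn M hp).mul (continuous_apply _).continuousOn)

lemma Fv_sum {r : ℕ} (M : MeanFieldModel r) (m : Fin r → ℝ) : ∑ k, Fv M m k = 0 := by
  simp only [Fv_div]
  rw [Finset.sum_comm]
  refine Finset.sum_eq_zero fun p _ => ?_
  rw [← Finset.sum_mul]
  simp [inc]

/-- C3 -/
lemma local_ctrl {r : ℕ} (hr : 0 < r) {M : MeanFieldModel r} {ξ₀ : Fin r → ℝ}
    (hξ₀ : ξ₀ ∈ stdSimplex ℝ (Fin r)) (heq : ∀ i : Fin r, ∑ j, M.lam j i ξ₀ * ξ₀ j = 0)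
    {ε : ℝ} (hε : 0 < ε) : ∃ δ > 0, ∀ ν ∈ stdSimplex ℝ (Fin r), dist ν ξ₀ < δ →
      SEnd M 1 ξ₀ ν ≤ ENNReal.ofReal ε := by
  obtain ⟨K, hK0, hK⟩ := Fv_lip M
  obtain ⟨θ, hθ⟩ := right_inv hr M
  obtain ⟨m0, hm0, hm0'⟩ : ∃ m0 > 0, ∀ i, m0 ≤ ξ₀ i := by
    have : Nonempty (Fin r) := ⟨⟨0, hr⟩⟩
    obtain ⟨i, hi⟩ := Finite.exists_min ξ₀
    exact ⟨ξ₀ i, equil_pos hξ₀ heq i, hi⟩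
  set Θ : ℝ := ∑ p ∈ M.E, ∑ i, |θ i p| with hΘ
  have hΘ0 : 0 ≤ Θ := Finset.sum_nonneg fun p _ => Finset.sum_nonneg fun i _ => abs_nonneg _
  have hc := M.c_pos
  set D : ℝ := (1 + K) * Θ / (m0 / 2 * M.c) with hD
  have hD0 : 0 ≤ D := by positivity
  set A : ℝ := M.E.card * |M.Cb| with hA
  have hA0 : 0 ≤ A := by positivity
  refine ⟨min (m0 / 2) (min (1 / (D + 1)) (ε / (A * D + 1))), by positivity, ?_⟩
  intro ν hν hd
  set v : Fin r → ℝ := ν - ξ₀ with hv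
  have hdv : dist ν ξ₀ = ‖v‖ := dist_eq_norm _ _
  rw [hdv, lt_min_iff, lt_min_iff] at hd
  obtain ⟨hd1, hd2, hd3⟩ := hd
  rw [lt_div_iff₀ (by positivity)] at hd2 hd3
  have hvn := norm_nonneg v
  have hvi : ∀ i, |v i| ≤ ‖v‖ := fun i => norm_le_pi_norm v i
  set κ : ℝ → ℝ := fun t => max 0 (min t 1) with hκ
  have hκ0 : ∀ t, 0 ≤ κ t := fun t => le_max_left _ _
  have hκ1 : ∀ t, κ t ≤ 1 := fun t => max_le zero_le_one (min_le_right _ _)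
  have hκt : ∀ t ∈ Icc (0:ℝ) 1, κ t = t := by
    intro t ht; simp only [hκ]; rw [min_eq_left ht.2, max_eq_right ht.1]
  set μ : ℝ → Fin r → ℝ := fun t i => ξ₀ i + κ t * (ν i - ξ₀ i) with hμ
  have hμS : ∀ t, μ t ∈ stdSimplex ℝ (Fin r) := fun t => simplex_seg hξ₀ hν (hκ0 t) (hκ1 t)
  have hμc : Continuous μ := by
    rw [hμ, hκ]; fun_prop
  have hμd : ∀ t, ‖μ t - ξ₀‖ ≤ ‖v‖ := by
    intro t
    have : μ t - ξ₀ = κ t • v := by ext i; simp [hμ, hv]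
    rw [this, norm_smul, Real.norm_of_nonneg (hκ0 t)]
    nlinarith [hκ1 t]
  have hμm : ∀ t i, m0 / 2 ≤ μ t i := by
    intro t i
    have h1 : |(μ t - ξ₀) i| ≤ ‖v‖ := (norm_le_pi_norm (μ t - ξ₀) i).trans (hμd t)
    have h2 := (abs_le.1 h1).1
    have h3 : (μ t - ξ₀) i = μ t i - ξ₀ i := rfl
    linarith [hm0' i]
  set g : ℝ → Fin r → ℝ := fun t k => v k - Fv M (μ t) k with hg
  have hg0 : ∀ t, ∑ k, g t k = 0 := by
    intro t
    simp only [hg, hv, Finset.sum_sub_distrib, Fv_sum, Pi.sub_apply, hν.2, hξ₀.2]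
    ring
  have hgb : ∀ t k, |g t k| ≤ (1 + K) * ‖v‖ := by
    intro t k
    have h1 := hK (μ t) (hμS t) ξ₀ hξ₀ k
    have h2 : Fv M ξ₀ k = 0 := heq k
    rw [h2, sub_zero] at h1
    have h3 := hμd t
    calc |g t k| ≤ |v k| + |Fv M (μ t) k| := abs_sub _ _
      _ ≤ ‖v‖ + K * ‖v‖ := add_le_add (hvi k) (h1.trans (by gcongr))
      _ = _ := by ring
  set W : ℝ → Fin r × Fin r → ℝ := fun t p => ∑ i, g t i * θ i p with hW
  have hWb : ∀ t, ∀ p ∈ M.E, |W t p| ≤ (1 + K) * ‖v‖ * Θ := by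
    intro t p hp
    calc |W t p| ≤ ∑ i, |g t i * θ i p| := Finset.abs_sum_le_sum_abs _ _
      _ ≤ ∑ i, (1 + K) * ‖v‖ * |θ i p| := Finset.sum_le_sum fun i _ => by
          rw [abs_mul]; gcongr; exact hgb t i
      _ = (1 + K) * ‖v‖ * ∑ i, |θ i p| := by rw [Finset.mul_sum]
      _ ≤ _ := by
          gcongr
          exact Finset.single_le_sum (f := fun p => ∑ i, |θ i p|)
            (fun p _ => Finset.sum_nonneg fun i _ => abs_nonneg _) hp
  have hub : ∀ t, ∀ p ∈ M.E, |W t p / (μ t p.1 * M.lam p.1 p.2 (μ t))| ≤ D * ‖v‖ := by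
    intro t p hp
    have h1 := hμm t p.1
    have h2 := M.lam_lower p hp (μ t) (hμS t)
    have h3 : 0 < μ t p.1 * M.lam p.1 p.2 (μ t) := mul_pos (by linarith) (by linarith)
    have h4 : 0 ≤ μ t p.1 := by linarith
    rw [abs_div, abs_of_pos h3]
    calc _ ≤ (1 + K) * ‖v‖ * Θ / (m0 / 2 * M.c) := by
          gcongr
          exact hWb t p hp
      _ = _ := by rw [hD]; ring
  have hDv : D * ‖v‖ ≤ 1 := by nlinarith
  set L0 : ℝ → Fin r → Fin r → ℝ := fun t i j =>
    if (i, j) ∈ M.E then M.lam i j (μ t) + W t (i, j) / μ t i else 0 with hL0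
  set L : ℝ → Fin r → Fin r → ℝ := fun t i j =>
    if i = j then -∑ j ∈ Finset.univ.filter (fun j => j ≠ i), L0 t i j else L0 t i j with hL
  have hLE : ∀ t, ∀ p ∈ M.E, L t p.1 p.2 = M.lam p.1 p.2 (μ t) + W t p / μ t p.1 := by
    rintro t ⟨a, b⟩ hp
    have hab : a ≠ b := fun h => M.no_diag a (by subst h; exact hp)
    simp only [hL, hL0, hab, hp, if_true, if_false]
  have hu : ∀ t, ∀ p ∈ M.E, L t p.1 p.2 / M.lam p.1 p.2 (μ t) - 1 =
      W t p / (μ t p.1 * M.lam p.1 p.2 (μ t)) := by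
    intro t p hp
    have h1 := hμm t p.1
    have h2 := M.lam_lower p hp (μ t) (hμS t)
    have h3 : M.lam p.1 p.2 (μ t) ≠ 0 := by intro h; linarith
    have h4 : μ t p.1 ≠ 0 := by intro h; linarith
    rw [hLE t p hp]
    field_simp
    ring
  have hFc : ∀ k, Continuous fun t => Fv M (μ t) k := fun k =>
    (Fv_contOn M k).comp_continuous hμc hμS
  have hL0m : ∀ i j, Measurable fun t => L0 t i j := by
    intro i j
    by_cases hE : (i, j) ∈ M.E
    · have h1 : Continuous fun t => M.lam i j (μ t) :=
        (lam_contOn M hE).comp_continuous hμc hμS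
      have h2 : Continuous fun t => W t (i, j) := by
        simp only [hW, hg]
        exact continuous_finsetSum _ fun k _ => (continuous_const.sub (hFc k)).mul continuous_const
      have h3 : Continuous fun t => μ t i := (continuous_apply i).comp hμc
      simp only [hL0, hE, if_true]
      exact h1.measurable.add (h2.measurable.div h3.measurable)
    · simp only [hL0, hE, if_false]; exact measurable_const
  have hL0L : ∀ t i, ∑ j ∈ Finset.univ.filter (fun j => j ≠ i), L0 t i j =
      ∑ j ∈ Finset.univ.filter (fun j => j ≠ i), L t i j := by
    intro t i
    refine Finset.sum_congr rfl fun j hj => ?_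
    have : j ≠ i := (Finset.mem_filter.1 hj).2
    simp only [hL, this.symm, if_false]
  have hR : IsRateMatrix M L := by
    refine ⟨fun i j => ?_, fun t i j hij => ?_, fun t i j hij hE => ?_, fun t i => ?_⟩
    · by_cases hij : i = j
      · simp only [hL, hij, if_true]
        exact (Finset.measurable_sum _ fun k _ => hL0m _ _).neg
      · simp only [hL, hij, if_false]; exact hL0m i j
    · by_cases hE : (i, j) ∈ M.E
      · have h1 := hu t _ hE
        have h2 := hub t _ hE
        have h3 := M.lam_lower _ hE (μ t) (hμS t)
        rw [← h1] at h2
        have h4 := (abs_le.1 (h2.trans hDv)).1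
        have h5 : 0 ≤ L t i j / M.lam i j (μ t) := by dsimp only at h4; linarith
        have h6 : 0 < M.lam i j (μ t) := hc.trans_le h3
        have := mul_nonneg h5 h6.le
        rwa [div_mul_cancel₀ _ h6.ne'] at this
      · simp only [hL, hL0, hij, hE, if_false]; exact le_rfl
    · simp only [hL, hL0, hij, hE, if_false]
    · rw [← hL0L]; simp only [hL, if_true]
  have hdiv : ∀ t i, ∑ j, L t j i * μ t j = v i := by
    intro t i
    rw [div_form M (L t) (μ t) (hR.2.2.1 t) (hR.2.2.2 t)]
    have e : ∀ p ∈ M.E, inc p i * (L t p.1 p.2 * μ t p.1) =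
        inc p i * (M.lam p.1 p.2 (μ t) * μ t p.1) + inc p i * W t p := by
      intro p hp
      have h1 := hμm t p.1
      have h4 : μ t p.1 ≠ 0 := by intro h; linarith
      rw [hLE t p hp]
      field_simp
    rw [Finset.sum_congr rfl e, Finset.sum_add_distrib, ← Fv_div, hθ (g t) (hg0 t) i]
    simp [hg]
  have hpath : IsPath M μ L 1 := by
    refine ⟨hR, fun i => ?_, fun t _ => hμS t⟩
    simp only [hdiv]
    apply Prm.mk' zero_le_one (by simp)
    intro t ht
    have h0 : κ 0 = 0 := hκt 0 ⟨le_rfl, zero_le_one⟩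
    simp only [hμ, h0, hκt t ht, intervalIntegral.integral_const, hv]
    simp
  refine (SEnd_le hpath ?_ ?_).trans ?_
  · ext i; simp [hμ, hκt 0 ⟨le_rfl, zero_le_one⟩]
  · ext i; simp [hμ, hκt 1 ⟨zero_le_one, le_rfl⟩]
  · rw [runningCost_eq]
    have hb : ∀ t, gcost M (μ t) (L t) ≤ ENNReal.ofReal ε := by
      intro t
      refine (gcost_le M (hμS t) (L t) hDv (fun p hp => ?_)).trans ?_
      · rw [hu t p hp]; exact hub t p hp
      · apply ENNReal.ofReal_le_ofReal
        rw [← hA]; nlinarith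
    refine (lintegral_mono (fun t => hb t)).trans ?_
    simp

lemma gron {f : ℝ → ℝ} (hf : Continuous f) {K δ T : ℝ} (hK : 0 ≤ K) (hT : 0 ≤ T)
    (h : ∀ t ∈ Icc 0 T, f t ≤ δ + K * ∫ s in (0:ℝ)..t, f s) : f T ≤ δ * Real.exp (K * T) := by
  set G : ℝ → ℝ := fun t => δ + K * ∫ s in (0:ℝ)..t, f s with hG
  have hGd : ∀ t, HasDerivAt G (K * f t) t := fun t =>
    ((intervalIntegral.integral_hasDerivAt_right (hf.intervalIntegrable _ _)
      (hf.stronglyMeasurableAtFilter _ _) hf.continuousAt).const_mul K).const_add δ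
  set H : ℝ → ℝ := fun t => Real.exp (-K * t) * G t with hH
  have hHd : ∀ t, HasDerivAt H (Real.exp (-K * t) * (-K) * G t + Real.exp (-K * t) * (K * f t)) t := by
    intro t
    have h1 : HasDerivAt (fun t : ℝ => Real.exp (-K * t)) (Real.exp (-K * t) * (-K)) t := by
      have := ((hasDerivAt_id t).const_mul (-K)).exp
      simpa using this
    exact h1.mul (hGd t)
  have hanti : AntitoneOn H (Icc 0 T) := by
    apply antitoneOn_of_deriv_nonpos (convex_Icc 0 T)
    · exact fun t _ => (hHd t).continuousAt.continuousWithinAt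
    · exact fun t _ => (hHd t).differentiableAt.differentiableWithinAt
    · intro t ht
      rw [interior_Icc] at ht
      rw [(hHd t).deriv]
      have h1 := h t ⟨ht.1.le, ht.2.le⟩
      have h2 : f t ≤ G t := h1
      have h3 := Real.exp_pos (-K * t)
      have : Real.exp (-K * t) * (-K) * G t + Real.exp (-K * t) * (K * f t) =
        - (Real.exp (-K * t) * (K * (G t - f t))) := by ring
      rw [this, neg_nonpos]
      exact mul_nonneg h3.le (mul_nonneg hK (by linarith))
  have h1 := hanti ⟨le_rfl, hT⟩ ⟨hT, le_rfl⟩ hT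
  have h2 : f T ≤ G T := h T ⟨hT, le_rfl⟩
  have h3 : H 0 = δ := by simp [hH, hG]
  rw [h3] at h1
  have h4 : G T = H T * Real.exp (K * T) := by
    simp only [hH]
    rw [mul_comm (Real.exp _) (G T), mul_assoc, ← Real.exp_add]; simp
  rw [h4] at h2
  exact h2.trans (mul_le_mul_of_nonneg_right h1 (Real.exp_pos _).le)

lemma Fv_bd {r : ℕ} (M : MeanFieldModel r) {m : Fin r → ℝ} (hm : m ∈ stdSimplex ℝ (Fin r))
    (k : Fin r) : |Fv M m k| ≤ M.E.card * |M.Cb| := by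
  rw [Fv_div]
  refine (Finset.abs_sum_le_sum_abs _ _).trans ?_
  calc _ ≤ ∑ p ∈ M.E, 1 * (|M.Cb| * 1) := Finset.sum_le_sum fun p hp => by
        rw [abs_mul, abs_mul]
        exact mul_le_mul (inc_abs _ _) (mul_le_mul (lam_abs M hm hp) (simplex_abs hm _)
          (abs_nonneg _) (abs_nonneg _)) (by positivity) zero_le_one
    _ = _ := by simp

lemma limit_sol {r : ℕ} (M : MeanFieldModel r) (x : ℕ → ℝ → Fin r → ℝ)
    (hc : ∀ n, Continuous (x n)) (hS : ∀ n t, x n t ∈ stdSimplex ℝ (Fin r)) {C : ℝ} (hC : 0 ≤ C)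
    (he : ∀ n : ℕ, ∀ t ∈ Icc (0:ℝ) (n + 1), ∀ i,
      |x n t i - x n 0 i - ∫ s in (0:ℝ)..t, Fv M (x n s) i| ≤ C * (1 + t) / (n + 1)) :
    ∃ (η : ℝ → Fin r → ℝ) (φ : ℕ → ℕ), StrictMono φ ∧ IsMVSolution M η ∧
      ∀ t, 0 ≤ t → Tendsto (fun n => x (φ n) t) atTop (nhds (η t)) := by
  obtain ⟨a, ha, φ, hφ, hlim⟩ := (isCompact_stdSimplex ℝ (Fin r)).tendsto_subseq (fun n => hS n 0)
  obtain ⟨K, hK0, hK⟩ := Fv_lip M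
  set y : ℕ → ℝ → Fin r → ℝ := fun n => x (φ n) with hy
  have hyc : ∀ n, Continuous (y n) := fun n => hc _
  have hyS : ∀ n t, y n t ∈ stdSimplex ℝ (Fin r) := fun n t => hS _ t
  have hyF : ∀ n i, Continuous fun s => Fv M (y n s) i := fun n i =>
    (Fv_contOn M i).comp_continuous (hyc n) (hyS n)
  have hye : ∀ n : ℕ, ∀ t ∈ Icc (0:ℝ) (n + 1), ∀ i,
      |y n t i - y n 0 i - ∫ s in (0:ℝ)..t, Fv M (y n s) i| ≤ C * (1 + t) / (n + 1) := by
    intro n t ht i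
    have hn : (n:ℝ) ≤ φ n := by exact_mod_cast hφ.id_le n
    refine (he (φ n) t ⟨ht.1, ht.2.trans (by linarith)⟩ i).trans ?_
    have := ht.1
    gcongr
  have hE0 : ∀ t : ℝ, Tendsto (fun n : ℕ => C * (1 + t) / (n + 1)) atTop (nhds 0) := by
    intro t
    exact tendsto_const_nhds.div_atTop
      (tendsto_atTop_add_const_right _ _ tendsto_natCast_atTop_atTop)
  have key : ∀ t : ℝ, 0 ≤ t → ∀ n m : ℕ, t ≤ n + 1 → t ≤ m + 1 → dist (y n t) (y m t) ≤
      (dist (y n 0) (y m 0) + C * (1 + t) / (n + 1) + C * (1 + t) / (m + 1)) * Real.exp (K * t) := by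
    intro t ht n m hn hm
    rw [dist_eq_norm]
    have hfc : Continuous fun s => ‖y n s - y m s‖ := ((hyc n).sub (hyc m)).norm
    refine gron (f := fun s => ‖y n s - y m s‖) hfc hK0 ht ?_
    intro s hs
    have hs0 := hs.1
    have hint : 0 ≤ ∫ u in (0:ℝ)..s, ‖y n u - y m u‖ :=
      intervalIntegral.integral_nonneg hs.1 fun u _ => norm_nonneg _
    have hts : 1 + s ≤ 1 + t := by linarith [hs.2]
    have hN : C * (1 + s) / ((n:ℝ) + 1) ≤ C * (1 + t) / (n + 1) := by gcongr
    have hM : C * (1 + s) / ((m:ℝ) + 1) ≤ C * (1 + t) / (m + 1) := by gcongr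
    refine (pi_norm_le_iff_of_nonneg (by positivity)).2 fun i => ?_
    rw [Real.norm_eq_abs]
    have h1 := (hye n s ⟨hs.1, hs.2.trans hn⟩ i).trans hN
    have h2 := (hye m s ⟨hs.1, hs.2.trans hm⟩ i).trans hM
    have h3 : |y n 0 i - y m 0 i| ≤ dist (y n 0) (y m 0) := by
      rw [dist_eq_norm]; exact norm_le_pi_norm (y n 0 - y m 0) i
    have h4 : |(∫ u in (0:ℝ)..s, Fv M (y n u) i) - ∫ u in (0:ℝ)..s, Fv M (y m u) i| ≤
        K * ∫ u in (0:ℝ)..s, ‖y n u - y m u‖ := by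
      rw [← intervalIntegral.integral_sub ((hyF n i).intervalIntegrable _ _)
        ((hyF m i).intervalIntegrable _ _), ← intervalIntegral.integral_const_mul]
      refine (intervalIntegral.abs_integral_le_integral_abs hs.1).trans ?_
      apply intervalIntegral.integral_mono_on hs.1
      · exact (((hyF n i).sub (hyF m i)).abs).intervalIntegrable _ _
      · exact (continuous_const.mul hfc).intervalIntegrable _ _
      · intro u _
        exact hK _ (hyS n u) _ (hyS m u) i
    simp only [Pi.sub_apply]
    rw [abs_le] at *
    constructor <;> linarith [h1.1, h1.2, h2.1, h2.2, h3.1, h3.2, h4.1, h4.2]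
  have hcauchy : ∀ t, 0 ≤ t → CauchySeq (fun n => y n t) := by
    intro t ht
    rw [cauchySeq_iff_tendsto_dist_atTop_0]
    have h0 : CauchySeq (fun n => y n 0) := hlim.cauchySeq
    rw [cauchySeq_iff_tendsto_dist_atTop_0] at h0
    have hf : Tendsto (fun p : ℕ × ℕ => p.1) atTop atTop := by
      rw [← prod_atTop_atTop_eq]; exact tendsto_fst
    have hs : Tendsto (fun p : ℕ × ℕ => p.2) atTop atTop := by
      rw [← prod_atTop_atTop_eq]; exact tendsto_snd
    have hb := ((h0.add ((hE0 t).comp hf)).add ((hE0 t).comp hs)).mul_const (Real.exp (K * t))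
    simp only [add_zero, zero_mul] at hb
    refine squeeze_zero' (Eventually.of_forall fun p => dist_nonneg) ?_ hb
    obtain ⟨N, hN⟩ := exists_nat_ge t
    filter_upwards [hf.eventually_ge_atTop N, hs.eventually_ge_atTop N] with p h1 h2
    have h1' : (N:ℝ) ≤ p.1 := by exact_mod_cast h1
    have h2' : (N:ℝ) ≤ p.2 := by exact_mod_cast h2
    exact key t ht p.1 p.2 (by linarith) (by linarith)
  have hex : ∀ t, 0 ≤ t → ∃ z, Tendsto (fun n => y n t) atTop (nhds z) := fun t ht =>
    cauchySeq_tendsto_of_complete (hcauchy t ht)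
  choose! η hη using hex
  have hηS : ∀ t, 0 ≤ t → η t ∈ stdSimplex ℝ (Fin r) := fun t ht =>
    (isClosed_stdSimplex ℝ (Fin r)).mem_of_tendsto (hη t ht) (Eventually.of_forall fun n => hyS n t)
  have hFlim : ∀ t, 0 ≤ t → ∀ i, Tendsto (fun n => Fv M (y n t) i) atTop (nhds (Fv M (η t) i)) := by
    intro t ht i
    have h1 := (Fv_contOn M i) (η t) (hηS t ht)
    exact h1.tendsto.comp (tendsto_nhdsWithin_iff.2 ⟨hη t ht, Eventually.of_forall fun n => hyS n t⟩)
  have hFm : ∀ T i, AEStronglyMeasurable (fun t => Fv M (η t) i) (volume.restrict (Icc 0 T)) := by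
    intro T i
    refine aestronglyMeasurable_of_tendsto_ae atTop
      (fun n => (hyF n i).aestronglyMeasurable) ?_
    filter_upwards [ae_restrict_mem measurableSet_Icc] with t ht using hFlim t ht.1 i
  refine ⟨η, φ, hφ, ⟨hηS, ?_, ?_⟩, hη⟩
  · intro T hT i
    refine Integrable.of_bound (hFm T i) (M.E.card * |M.Cb|) ?_
    filter_upwards [ae_restrict_mem measurableSet_Icc] with t ht
    exact Fv_bd M (hηS t ht.1) i
  · intro t ht i
    have h1 : Tendsto (fun n => ∫ s in Ioc 0 t, Fv M (y n s) i) atTop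
        (nhds (∫ s in Ioc 0 t, Fv M (η s) i)) := by
      refine tendsto_integral_of_dominated_convergence (fun _ => M.E.card * |M.Cb|)
        (fun n => (hyF n i).aestronglyMeasurable) (integrable_const _) ?_ ?_
      · exact fun n => Eventually.of_forall fun s => Fv_bd M (hyS n s) i
      · filter_upwards [ae_restrict_mem measurableSet_Ioc] with s hs using hFlim s hs.1.le i
    have h2 : Tendsto (fun n => y n t i - y n 0 i - ∫ s in Ioc 0 t, Fv M (y n s) i) atTop
        (nhds (η t i - η 0 i - ∫ s in Ioc 0 t, Fv M (η s) i)) :=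
      ((tendsto_pi_nhds.1 (hη t ht) i).sub (tendsto_pi_nhds.1 (hη 0 le_rfl) i)).sub h1
    have h3 : Tendsto (fun n => y n t i - y n 0 i - ∫ s in Ioc 0 t, Fv M (y n s) i) atTop
        (nhds 0) := by
      refine squeeze_zero_norm' ?_ (hE0 t)
      obtain ⟨N, hN⟩ := exists_nat_ge t
      filter_upwards [eventually_ge_atTop N] with n hn
      have h1' : (N:ℝ) ≤ n := by exact_mod_cast hn
      have := hye n t ⟨ht, by linarith⟩ i
      rwa [intervalIntegral.integral_of_le ht] at this
    have h4 := tendsto_nhds_unique h2 h3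
    change η t i = η 0 i + ∫ s in Ioc 0 t, Fv M (η s) i
    linarith

lemma path_cont {r : ℕ} {M : MeanFieldModel r} {μ : ℝ → Fin r → ℝ}
    {L : ℝ → Fin r → Fin r → ℝ} {T : ℝ} (h : IsPath M μ L T) : ContinuousOn μ (Icc 0 T) :=
  continuousOn_pi.2 fun i => (h.2.1 i).cont

lemma err_pt {r : ℕ} (M : MeanFieldModel r) {m : Fin r → ℝ} (hm : m ∈ stdSimplex ℝ (Fin r))
    {l : Fin r → Fin r → ℝ} (hl0 : ∀ i j, i ≠ j → 0 ≤ l i j)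
    (hoff : ∀ i j : Fin r, i ≠ j → (i, j) ∉ M.E → l i j = 0)
    (hdiag : ∀ i : Fin r, l i i = -∑ j ∈ Finset.univ.filter (fun j => j ≠ i), l i j)
    {a : ℝ} (ha : 0 < a) (ha1 : a ≤ 1) (k : Fin r) :
    ENNReal.ofReal |∑ j, l j k * m j - Fv M m k| ≤
      gcost M m l * ENNReal.ofReal (1 / a) + ENNReal.ofReal (a * (M.E.card * |M.Cb|)) := by
  have hu : ∀ p ∈ M.E, -1 ≤ l p.1 p.2 / M.lam p.1 p.2 m - 1 := by
    intro p hp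
    have h1 := M.c_pos.trans_le (M.lam_lower p hp m hm)
    have h2 := hl0 p.1 p.2 (fun h => M.no_diag p.1 (by
      have : p = (p.1, p.1) := Prod.ext rfl h.symm
      rw [← this]; exact hp))
    have := div_nonneg h2 h1.le
    linarith
  have hcn : 0 ≤ ∑ p ∈ M.E, m p.1 * M.lam p.1 p.2 m * tauStar (l p.1 p.2 / M.lam p.1 p.2 m - 1) :=
    Finset.sum_nonneg fun p hp => mul_nonneg (mul_nonneg (hm.1 _)
      (M.c_pos.le.trans (M.lam_lower p hp m hm))) (tauStar_nonneg (hu p hp))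
  unfold gcost
  rw [← ENNReal.ofReal_mul hcn, ← ENNReal.ofReal_add (by positivity) (by positivity)]
  apply ENNReal.ofReal_le_ofReal
  rw [div_form M l m hoff hdiag, Fv_div, ← Finset.sum_sub_distrib, Finset.sum_mul]
  have e : a * (M.E.card * |M.Cb|) = ∑ p ∈ M.E, a * |M.Cb| := by simp; ring
  rw [e, ← Finset.sum_add_distrib]
  refine (Finset.abs_sum_le_sum_abs _ _).trans (Finset.sum_le_sum fun p hp => ?_)
  have h1 := M.c_pos.trans_le (M.lam_lower p hp m hm)
  have h2 := hm.1 p.1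
  have h3 := tauStar_ge ha ha1 (hu p hp)
  have h4 := (le_abs_self _).trans (lam_abs M hm hp)
  have h5 := (le_abs_self _).trans (simplex_abs hm p.1)
  set u := l p.1 p.2 / M.lam p.1 p.2 m - 1 with hud
  have e2 : inc p k * (l p.1 p.2 * m p.1) - inc p k * (M.lam p.1 p.2 m * m p.1) =
      inc p k * (m p.1 * M.lam p.1 p.2 m * u) := by
    rw [hud]; field_simp
  have h6 : 0 ≤ m p.1 * M.lam p.1 p.2 m := mul_nonneg h2 h1.le
  rw [e2, abs_mul, abs_mul, abs_of_nonneg h6]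
  have h7 : m p.1 * M.lam p.1 p.2 m ≤ 1 * |M.Cb| := by gcongr
  calc _ ≤ 1 * (m p.1 * M.lam p.1 p.2 m * (tauStar u / a + a)) := by
        gcongr; exact inc_abs _ _
    _ = m p.1 * M.lam p.1 p.2 m * tauStar u * (1 / a) + a * (m p.1 * M.lam p.1 p.2 m) := by ring
    _ ≤ _ := by
        rw [one_mul] at h7
        gcongr

lemma err_path {r : ℕ} {M : MeanFieldModel r} {μ : ℝ → Fin r → ℝ}
    {L : ℝ → Fin r → Fin r → ℝ} {T : ℝ} (h : IsPath M μ L T) {a J : ℝ} (ha : 0 < a) (ha1 : a ≤ 1)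
    (hJ : 0 ≤ J) (hJc : runningCost M μ L T ≤ ENNReal.ofReal J) {t : ℝ} (ht : t ∈ Icc 0 T)
    (i : Fin r) : |μ t i - μ 0 i - ∫ s in (0:ℝ)..t, Fv M (μ s) i| ≤
      J * (1 / a) + a * (M.E.card * |M.Cb|) * t := by
  have ht0 := ht.1
  have h0 : (0:ℝ) ∈ Icc 0 T := ⟨le_rfl, ht.1.trans ht.2⟩
  have hFc : ContinuousOn (fun s => Fv M (μ s) i) (Icc 0 T) :=
    (Fv_contOn M i).comp (path_cont h) h.2.2
  have hFi : IntervalIntegrable (fun s => Fv M (μ s) i) volume 0 t := by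
    apply ContinuousOn.intervalIntegrable
    rw [uIcc_of_le ht.1]
    exact hFc.mono (Icc_subset_Icc le_rfl ht.2)
  have hd := (h.2.1 i).diff h0 ht
  rw [hd, add_sub_cancel_left, ← intervalIntegral.integral_sub ((h.2.1 i).ii h0 ht) hFi,
    intervalIntegral.integral_of_le ht.1]
  rw [← ENNReal.ofReal_le_ofReal_iff (by positivity), ← Real.norm_eq_abs, ofReal_norm]
  refine (enorm_integral_le_lintegral_enorm _).trans ?_
  calc _ ≤ ∫⁻ s in Ioc 0 t, (gcost M (μ s) (L s) * ENNReal.ofReal (1 / a) +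
        ENNReal.ofReal (a * (M.E.card * |M.Cb|))) := by
        refine setLIntegral_mono' measurableSet_Ioc fun s hs => ?_
        rw [← ofReal_norm, Real.norm_eq_abs]
        exact err_pt M (h.2.2 s ⟨hs.1.le, hs.2.trans ht.2⟩) (h.1.2.1 s) (h.1.2.2.1 s)
          (h.1.2.2.2 s) ha ha1 i
    _ = (∫⁻ s in Ioc 0 t, gcost M (μ s) (L s)) * ENNReal.ofReal (1 / a) +
        ENNReal.ofReal (a * (M.E.card * |M.Cb|)) * ENNReal.ofReal t := by
        rw [lintegral_add_right _ measurable_const, lintegral_mul_const' _ _ ofReal_ne_top]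
        simp
    _ ≤ ENNReal.ofReal J * ENNReal.ofReal (1 / a) +
        ENNReal.ofReal (a * (M.E.card * |M.Cb|)) * ENNReal.ofReal t := by
        gcongr
        refine le_trans ?_ hJc
        rw [runningCost_eq]
        exact lintegral_mono_set (Ioc_subset_Ioc le_rfl ht.2)
    _ = _ := by
        rw [← ENNReal.ofReal_mul hJ, ← ENNReal.ofReal_mul (by positivity),
          ← ENNReal.ofReal_add (by positivity) (by positivity)]

/-- C4 -/
lemma hitting {r : ℕ} {M : MeanFieldModel r} {ξ₀ : Fin r → ℝ} (hG : IsUniqueGASEquilibrium M ξ₀)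
    {δ : ℝ} (hδ : 0 < δ) : ∃ T > 0, ∃ c > 0, ∀ μ L, IsPath M μ L T →
      runningCost M μ L T ≤ ENNReal.ofReal c → ∃ t ∈ Icc (0:ℝ) T, dist (μ t) ξ₀ < δ := by
  by_contra hcon
  push Not at hcon
  have hcon' : ∀ n : ℕ, ∃ μ L, IsPath M μ L (n + 1) ∧
      runningCost M μ L (n + 1) ≤ ENNReal.ofReal (1 / ((n:ℝ) + 1) ^ 2) ∧
      ∀ t ∈ Icc (0:ℝ) (n + 1), δ ≤ dist (μ t) ξ₀ := fun n =>
    hcon (n + 1) (by positivity) (1 / ((n:ℝ) + 1) ^ 2) (by positivity)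
  choose μ L hp hcost hdist using hcon'
  set κ : ℕ → ℝ → ℝ := fun n t => max 0 (min t (n + 1)) with hκ
  have hκI : ∀ (n : ℕ) (t : ℝ), κ n t ∈ Icc (0:ℝ) (n + 1) := fun n t =>
    ⟨le_max_left _ _, max_le (by positivity) (min_le_right _ _)⟩
  have hκt : ∀ n : ℕ, ∀ t ∈ Icc (0:ℝ) (n + 1), κ n t = t := by
    intro n t ht; simp only [hκ]; rw [min_eq_left ht.2, max_eq_right ht.1]
  have hκc : ∀ n, Continuous (κ n) := fun n => by simp only [hκ]; fun_prop
  obtain ⟨η, φ, hφ, hMV, hlim⟩ := limit_sol M (fun n t => μ n (κ n t))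
    (fun n => (path_cont (hp n)).comp_continuous (hκc n) (hκI n))
    (fun n t => (hp n).2.2 _ (hκI n t)) (C := 1 + M.E.card * |M.Cb|) (by positivity) (by
      intro n t ht i
      have hn : (0:ℝ) < n + 1 := by positivity
      have h1 := err_path (hp n) (a := 1 / ((n:ℝ) + 1)) (by positivity)
        (by rw [div_le_one hn]; linarith [(Nat.cast_nonneg n : (0:ℝ) ≤ n)]) (by positivity) (hcost n) ht i
      have h2 : ∫ s in (0:ℝ)..t, Fv M (μ n (κ n s)) i = ∫ s in (0:ℝ)..t, Fv M (μ n s) i := by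
        apply intervalIntegral.integral_congr
        intro s hs
        rw [uIcc_of_le ht.1] at hs
        dsimp only
        rw [hκt n s ⟨hs.1, hs.2.trans ht.2⟩]
      rw [h2, hκt n t ht, hκt n 0 ⟨le_rfl, hn.le⟩]
      refine h1.trans ?_
      have e : 1 / ((n:ℝ) + 1) ^ 2 * (1 / (1 / ((n:ℝ) + 1))) +
        1 / ((n:ℝ) + 1) * (M.E.card * |M.Cb|) * t = (1 + M.E.card * |M.Cb| * t) / (n + 1) := by
        field_simp
      rw [e]
      have ht0 := ht.1
      have hA : (0:ℝ) ≤ M.E.card * |M.Cb| := by positivity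
      apply div_le_div_of_nonneg_right _ hn.le
      nlinarith)
  have hη := hG.2.2 η hMV
  have hev := (hη.eventually (Metric.ball_mem_nhds ξ₀ hδ)).and (eventually_ge_atTop 0)
  obtain ⟨t, ht1, ht0⟩ := hev.exists
  have hev2 := (hlim t ht0).eventually (Metric.isOpen_ball.mem_nhds ht1)
  obtain ⟨N, hN⟩ := exists_nat_ge t
  obtain ⟨n, hn1, hn2⟩ := (hev2.and (eventually_ge_atTop N)).exists
  have hn3 : (N:ℝ) ≤ φ n := by exact_mod_cast hn2.trans (hφ.id_le n)
  exact absurd hn1 (not_lt.2 (hdist (φ n) _ (hκI (φ n) t)))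

lemma dpe_le {r : ℕ} {M : MeanFieldModel r} {s : (Fin r → ℝ) → ℝ} (hD : SatisfiesDPE M s)
    {T : ℝ} (hT : 0 < T) {ν ξ : Fin r → ℝ} (hν : ν ∈ stdSimplex ℝ (Fin r))
    (hξ : ξ ∈ stdSimplex ℝ (Fin r)) :
    ENNReal.ofReal (s ξ) ≤ ENNReal.ofReal (s ν) + SEnd M T ν ξ := by
  rw [hD T hT ξ hξ]
  exact iInf₂_le ν hν

lemma dpe_near {r : ℕ} {M : MeanFieldModel r} {s : (Fin r → ℝ) → ℝ} (hD : SatisfiesDPE M s)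
    (hs : ∀ ξ ∈ stdSimplex ℝ (Fin r), 0 ≤ s ξ)
    {T : ℝ} (hT : 0 < T) {ξ : Fin r → ℝ} (hξ : ξ ∈ stdSimplex ℝ (Fin r)) {ε : ℝ} (hε : 0 < ε) :
    ∃ μ L, IsPath M μ L T ∧ μ T = ξ ∧ ∃ k : ℝ, 0 ≤ k ∧ runningCost M μ L T = ENNReal.ofReal k ∧
      s (μ 0) + k < s ξ + ε := by
  have h1 : ENNReal.ofReal (s ξ) < ENNReal.ofReal (s ξ + ε) :=
    (ENNReal.ofReal_lt_ofReal_iff (by linarith [hs ξ hξ])).2 (by linarith)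
  rw [hD T hT ξ hξ] at h1
  simp only [iInf_lt_iff] at h1
  obtain ⟨ν, hν, h2⟩ := h1
  have h3 : SEnd M T ν ξ < ENNReal.ofReal (s ξ + ε) - ENNReal.ofReal (s ν) :=
    lt_tsub_iff_left.2 h2
  obtain ⟨μ, L, hp, h0, hT', hc⟩ := exists_of_SEnd_lt h3
  have hne : runningCost M μ L T ≠ ⊤ := hc.ne_top
  refine ⟨μ, L, hp, hT', (runningCost M μ L T).toReal, toReal_nonneg, (ofReal_toReal hne).symm, ?_⟩
  rw [h0]
  have h4 := lt_tsub_iff_left.1 hc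
  rw [← ofReal_toReal hne, ← ENNReal.ofReal_add (hs ν hν) toReal_nonneg] at h4
  exact (ENNReal.ofReal_lt_ofReal_iff_of_nonneg (add_nonneg (hs ν hν) toReal_nonneg)).1 h4

lemma path_mem {r : ℕ} {M : MeanFieldModel r} {μ : ℝ → Fin r → ℝ}
    {L : ℝ → Fin r → Fin r → ℝ} {T : ℝ} (h : IsPath M μ L T) {t : ℝ} (ht : t ∈ Icc 0 T) :
    μ t ∈ stdSimplex ℝ (Fin r) := h.2.2 t ht

lemma s_zero {r : ℕ} {M : MeanFieldModel r} {ξ₀ : Fin r → ℝ} (hG : IsUniqueGASEquilibrium M ξ₀)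
    {s : (Fin r → ℝ) → ℝ} (hs : ∀ ξ ∈ stdSimplex ℝ (Fin r), 0 ≤ s ξ)
    (hlsc : LowerSemicontinuousOn s (stdSimplex ℝ (Fin r))) (hD : SatisfiesDPE M s)
    (hzero : ∃ ν ∈ stdSimplex ℝ (Fin r), s ν = 0) : s ξ₀ ≤ 0 := by
  obtain ⟨ν, hν, hν0⟩ := hzero
  by_contra hcon
  push Not at hcon
  have h1 := hlsc ξ₀ hG.1 (s ξ₀ / 2) (by linarith)
  rw [eventually_nhdsWithin_iff, Metric.eventually_nhds_iff] at h1
  obtain ⟨δ, hδ, hδ'⟩ := h1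
  obtain ⟨T, hT, c, hc, hit⟩ := hitting hG hδ
  obtain ⟨μ, L, hp, hTe, k, hk, hck, hlt⟩ := dpe_near hD hs hT hν (ε := min c (s ξ₀ / 2))
    (lt_min hc (by linarith))
  have h0 : 0 ≤ s (μ 0) := hs _ (path_mem hp ⟨le_rfl, hT.le⟩)
  have hm1 := min_le_left c (s ξ₀ / 2)
  have hm2 := min_le_right c (s ξ₀ / 2)
  obtain ⟨t, ht, htd⟩ := hit μ L hp (by
    rw [hck]; exact ENNReal.ofReal_le_ofReal (by linarith))
  have hb := hδ' htd (path_mem hp ht)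
  rcases ht.1.eq_or_lt with h | h
  · rw [← h] at hb; linarith
  · obtain ⟨hp', hc'⟩ := hp.shift le_rfl h.le ht.2
    have h3 := SEnd_le hp' rfl rfl
    have h4 := dpe_le hD (T := t - 0) (by linarith) (path_mem hp ⟨le_rfl, hT.le⟩) (path_mem hp ht)
    simp only [add_zero, sub_zero, zero_add] at h3 h4 hc'
    have h5 : ENNReal.ofReal (s (μ t)) ≤ ENNReal.ofReal (s (μ 0) + k) := by
      rw [ENNReal.ofReal_add h0 hk, ← hck]
      exact h4.trans (add_le_add le_rfl (h3.trans hc'))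
    have h6 := (ENNReal.ofReal_le_ofReal_iff (by linarith)).1 h5
    linarith

lemma quasi_le {r : ℕ} (hr : 0 < r) {M : MeanFieldModel r} {ξ₀ : Fin r → ℝ}
    (hG : IsUniqueGASEquilibrium M ξ₀)
    {s : (Fin r → ℝ) → ℝ} (hs : ∀ ξ ∈ stdSimplex ℝ (Fin r), 0 ≤ s ξ)
    (hD : SatisfiesDPE M s) {ξ : Fin r → ℝ} (hξ : ξ ∈ stdSimplex ℝ (Fin r)) {ε : ℝ} (hε : 0 < ε) :
    quasipotential M ξ₀ ξ ≤ ENNReal.ofReal (s ξ + (ε + ε)) := by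
  obtain ⟨δ, hδ, hloc⟩ := local_ctrl hr hG.1 hG.2.1 hε
  obtain ⟨T, hT, c, hc, hit⟩ := hitting hG hδ
  have step : ∀ e : ℝ, 0 < e → e ≤ c / 2 → ∀ (n : ℕ) (ξ : Fin r → ℝ), ξ ∈ stdSimplex ℝ (Fin r) →
      s ξ ≤ n * (c / 2) → quasipotential M ξ₀ ξ ≤ ENNReal.ofReal (s ξ + ε + (n + 1) * e) := by
    intro e he hec n
    have hhit : ∀ μ L, IsPath M μ L T → ∀ k : ℝ, 0 ≤ k → k ≤ c →
        runningCost M μ L T = ENNReal.ofReal k →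
        quasipotential M ξ₀ (μ T) ≤ ENNReal.ofReal (ε + k) := by
      intro μ L hp k hk hkc hck
      obtain ⟨t, ht, htd⟩ := hit μ L hp (by rw [hck]; exact ENNReal.ofReal_le_ofReal hkc)
      obtain ⟨hp', hc'⟩ := hp.shift ht.1 ht.2 le_rfl
      have h1 := quasi_triangle (by linarith [ht.2]) hp' ξ₀
      simp only [add_zero, add_sub_cancel] at h1
      have h2 : quasipotential M ξ₀ (μ t) ≤ ENNReal.ofReal ε :=
        (iInf₂_le (1:ℝ) one_pos).trans (hloc _ (path_mem hp ht) htd)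
      rw [ENNReal.ofReal_add hε.le hk, ← hck]
      exact h1.trans (add_le_add h2 hc')
    induction n with
    | zero =>
      intro ξ hξ hsn
      obtain ⟨μ, L, hp, hTe, k, hk, hck, hlt⟩ := dpe_near hD hs hT hξ he
      have h0 : 0 ≤ s (μ 0) := hs _ (path_mem hp ⟨le_rfl, hT.le⟩)
      simp only [Nat.cast_zero, zero_mul] at hsn
      have := hhit μ L hp k hk (by linarith) hck
      rw [hTe] at this
      refine this.trans (ENNReal.ofReal_le_ofReal ?_)
      push_cast; linarith
    | succ n ih =>
      intro ξ hξ hsn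
      obtain ⟨μ, L, hp, hTe, k, hk, hck, hlt⟩ := dpe_near hD hs hT hξ he
      have hm0 := path_mem hp (t := 0) ⟨le_rfl, hT.le⟩
      have h0 : 0 ≤ s (μ 0) := hs _ hm0
      have hne : 0 ≤ (n:ℝ) * e := by positivity
      push_cast at hsn
      by_cases hkc : k ≤ c
      · have := hhit μ L hp k hk hkc hck
        rw [hTe] at this
        refine this.trans (ENNReal.ofReal_le_ofReal ?_)
        push_cast; linarith
      · push Not at hkc
        have h1 := ih (μ 0) hm0 (by linarith)
        have h2 := quasi_triangle hT.le hp ξ₀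
        rw [hTe, hck] at h2
        refine (h2.trans (add_le_add h1 le_rfl)).trans ?_
        rw [← ENNReal.ofReal_add (by positivity) hk]
        apply ENNReal.ofReal_le_ofReal
        push_cast; linarith
  obtain ⟨N, hN⟩ := exists_nat_ge (s ξ / (c / 2))
  have hN1 : (0:ℝ) < N + 1 := by positivity
  have h := step (min (c / 2) (ε / (N + 1))) (lt_min (by linarith) (by positivity))
    (min_le_left _ _) N ξ hξ ((div_le_iff₀ (by linarith)).1 hN)
  refine h.trans (ENNReal.ofReal_le_ofReal ?_)
  have h1 : ((N:ℝ) + 1) * min (c / 2) (ε / (N + 1)) ≤ (N + 1) * (ε / (N + 1)) :=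
    mul_le_mul_of_nonneg_left (min_le_right _ _) hN1.le
  rw [mul_div_cancel₀ _ hN1.ne'] at h1
  linarith

/-- if the McKean–Vlasov equation has a unique globally
asymptotically stable equilibrium `ξ₀`, then any `s ≥ 0` lower semicontinuous on
`M₁(Z)`, satisfying the dynamic programming equation and vanishing somewhere, is
uniquely determined:  `s(ξ)` equals the infimum of the infinite-horizon running
cost over all reversed-time controlled paths in `M₁(Z)` from `ξ` converging to
`ξ₀`. -/
theorem stmt12 (r : ℕ) (hr : 0 < r) (M : MeanFieldModel r)
    (ξ₀ : Fin r → ℝ) (hGAS : IsUniqueGASEquilibrium M ξ₀)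
    (s : (Fin r → ℝ) → ℝ)
    (hs_nonneg : ∀ ξ ∈ stdSimplex ℝ (Fin r), 0 ≤ s ξ)
    (hs_lsc : LowerSemicontinuousOn s (stdSimplex ℝ (Fin r)))
    (hDPE : SatisfiesDPE M s)
    (hzero : ∃ ν ∈ stdSimplex ℝ (Fin r), s ν = 0) :
    ∀ ξ ∈ stdSimplex ℝ (Fin r),
      ENNReal.ofReal (s ξ) =
        ⨅ (μ : ℝ → Fin r → ℝ) (L : ℝ → Fin r → Fin r → ℝ)
          (_ : IsRateMatrix M L ∧ SolvesReversedODE L μ ∧ μ 0 = ξ ∧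
            (∀ t : ℝ, 0 ≤ t → μ t ∈ stdSimplex ℝ (Fin r)) ∧
            Tendsto μ atTop (nhds ξ₀)),
          runningCostInf M μ L := by
  intro ξ hξ
  have hz := s_zero hGAS hs_nonneg hs_lsc hDPE hzero
  have heps : ∀ {a b : ℝ≥0∞}, (∀ ε : ℝ, 0 < ε → a ≤ b + ENNReal.ofReal (ε + ε)) → a ≤ b := by
    intro a b h
    refine ENNReal.le_of_forall_pos_le_add fun e he _ => ?_
    have := h ((e : ℝ) / 2) (by positivity)
    rwa [add_halves, ENNReal.ofReal_coe_nnreal] at this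
  apply le_antisymm
  · refine le_iInf fun μ => le_iInf fun L => le_iInf fun h => ?_
    obtain ⟨hL, hode, h0, hm, hlim⟩ := h
    refine heps fun ε hε => ?_
    obtain ⟨δ, hδ, hloc⟩ := local_ctrl hr hGAS.1 hGAS.2.1 (add_pos hε hε)
    have hev := (hlim.eventually (Metric.ball_mem_nhds ξ₀ hδ)).and (eventually_gt_atTop (0:ℝ))
    obtain ⟨T, hT1, hT0⟩ := hev.exists
    have h1 := dpe_le hDPE hT0 (hm T hT0.le) (hm 0 le_rfl)
    have h2 := dpe_le hDPE one_pos hGAS.1 (hm T hT0.le)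
    rw [ENNReal.ofReal_of_nonpos hz, zero_add] at h2
    rw [← h0, add_comm]
    exact h1.trans (add_le_add (h2.trans (hloc _ (hm T hT0.le) hT1)) (SEnd_le_rev hL hode hm hT0))
  · refine (rhs_le hGAS.1 hGAS.2.1).trans (heps fun ε hε => ?_)
    rw [← ENNReal.ofReal_add (hs_nonneg ξ hξ) (by positivity)]
    exact quasi_le hr hGAS hs_nonneg hDPE hξ hε
end

section
/- Let X be a Polish space, Z a finite set, π_0 : X → Z a continuous map, ν a probability measure on Z, and for each z ∈ Z let P_z be a Borel probability measure on X with P_z({x : π_0(x) = z}) = 1. Set P = Σ_{z∈Z} ν(z) P_z. If Q is a Borel probability measure on X whose pushforward under π_0 equals ν, then H(Q|P) ≤ J(Q), where H(Q|P) is the relative entropy of Q with respect to P and J(Q) = sup over bounded continuous f of [ ∫_X f dQ − Σ_{z∈Z} ν(z) log ∫_X e^f dP_z ]. -/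
open MeasureTheory BoundedContinuousFunction ENNReal

noncomputable section
open scoped Classical

/-- The rate function
`J(Q) = sup_{f ∈ C_b(X)} [ ∫_X f dQ − Σ_{z∈Z} ν(z) log ∫_X e^f dP_z ] ∈ [0,∞]`
(the supremum over bounded continuous `f`; since `f = 0` contributes `0`, the
supremum is nonnegative and may be computed in `[0,∞]` via `ENNReal.ofReal`). -/
def Jfun {X : Type*} [TopologicalSpace X] [MeasurableSpace X]
    {Z : Type*} [Fintype Z] [MeasurableSpace Z]
    (ν : Measure Z) (P : Z → Measure X) (Q : Measure X) : ℝ≥0∞ :=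
  ⨆ f : X →ᵇ ℝ, ENNReal.ofReal
    (∫ x, f x ∂Q - ∑ z : Z, (ν {z}).toReal * Real.log (∫ x, Real.exp (f x) ∂(P z)))

/-- The relative entropy `H(Q|P) = ∫ log (dQ/dP) dQ` if `Q ≪ P` (with value `∞`
if the integral diverges), and `H(Q|P) = ∞` otherwise.  Here
`llr Q P x = log (dQ/dP)(x)` is the log-likelihood ratio. -/
def relEnt {X : Type*} [MeasurableSpace X] (Q P : Measure X) : ℝ≥0∞ :=
  if Q ≪ P ∧ Integrable (llr Q P) Q
  then ENNReal.ofReal (∫ x, llr Q P x ∂Q)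
  else ⊤

end

lemma aux_exp {a b M : ℝ} (hb : b ≤ M) (h : 0 ≤ M) :
    Real.exp b ≤ Real.exp a + Real.exp M * |a - b| := by
  have h1 : Real.exp b - Real.exp a ≤ Real.exp b * (b - a) := by
    have := Real.add_one_le_exp (a - b)
    have h2 : Real.exp a = Real.exp b * Real.exp (a - b) := by rw [← Real.exp_add]; congr 1; ring
    nlinarith [Real.exp_pos b]
  have h3 : Real.exp b * (b - a) ≤ Real.exp M * |a - b| := by
    have : b - a ≤ |a - b| := by rw [abs_sub_comm]; exact le_abs_self _
    have h4 := Real.exp_le_exp.2 hb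
    nlinarith [Real.exp_pos b, abs_nonneg (a - b)]
  linarith

lemma aux_clamp {a g M : ℝ} (ha : |a| ≤ M) : |a - max (-M) (min g M)| ≤ |a - g| := by
  rw [abs_le] at ha
  rcases max_cases (-M) (min g M) with h | h <;> rcases min_cases g M with h' | h' <;>
    rcases abs_cases (a - g) with h'' | h'' <;> rw [abs_le] <;> constructor <;> linarith

lemma aux_integrable {X : Type*} [MeasurableSpace X] (P : Measure X) [IsFiniteMeasure P]
    {f : X → ℝ} (hf : Measurable f) {M : ℝ} (hM : ∀ x, |f x| ≤ M) : Integrable f P :=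
  Integrable.of_bound hf.aestronglyMeasurable M (Filter.Eventually.of_forall hM)

lemma aux_integrable_exp {X : Type*} [MeasurableSpace X] (P : Measure X) [IsFiniteMeasure P]
    {f : X → ℝ} (hf : Measurable f) {M : ℝ} (hM : ∀ x, |f x| ≤ M) :
    Integrable (fun x => Real.exp (f x)) P := by
  apply aux_integrable P (by fun_prop) (M := Real.exp M)
  intro x
  rw [abs_of_pos (Real.exp_pos _)]
  exact Real.exp_le_exp.2 ((le_abs_self _).trans (hM x))

lemma aux_meas {X : Type*} [TopologicalSpace X] [PolishSpace X]
    [MeasurableSpace X] [BorelSpace X] (P Q : Measure X) [IsProbabilityMeasure P]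
    [IsProbabilityMeasure Q] (C : ℝ)
    (H : ∀ f : X →ᵇ ℝ, ∫ x, f x ∂Q - (∫ x, Real.exp (f x) ∂P - 1) ≤ C)
    (f : X → ℝ) (hf : Measurable f) (M : ℝ) (hM : ∀ x, |f x| ≤ M) (hM0 : 0 ≤ M) :
    ∫ x, f x ∂Q - (∫ x, Real.exp (f x) ∂P - 1) ≤ C := by
  apply _root_.le_of_forall_pos_le_add
  intro δ hδ
  have hE := Real.exp_pos M
  obtain ⟨g, hg, -⟩ := (aux_integrable (P + Q) hf hM).exists_boundedContinuous_integral_sub_le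
    (ε := δ / (1 + Real.exp M)) (by positivity)
  let g' : X →ᵇ ℝ := BoundedContinuousFunction.ofNormedAddCommGroup
    (fun x => max (-M) (min (g x) M)) (by fun_prop) M (by
      intro x
      rw [Real.norm_eq_abs, abs_le]
      exact ⟨le_max_left _ _, max_le (by linarith) (min_le_right _ _)⟩)
  have hg'def : ∀ x, g' x = max (-M) (min (g x) M) := fun x => rfl
  have hg'M : ∀ x, |g' x| ≤ M := by
    intro x
    rw [hg'def, abs_le]
    exact ⟨le_max_left _ _, max_le (by linarith) (min_le_right _ _)⟩
  have hg'm : Measurable g' := g'.continuous.measurable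
  have hdM : ∀ x, |(|f x - g' x|)| ≤ 2 * M := by
    intro x
    rw [abs_abs]
    have := abs_sub (f x) (g' x)
    linarith [hM x, hg'M x]
  have hdm : Measurable (fun x => |f x - g' x|) := by fun_prop
  have hd : ∫ x, |f x - g' x| ∂(P + Q) ≤ δ / (1 + Real.exp M) := by
    refine le_trans (integral_mono (aux_integrable _ hdm hdM) ?_ ?_) hg
    · exact ((aux_integrable _ hf hM).sub (g.integrable _)).norm
    · intro x
      exact aux_clamp (hM x)
  rw [integral_add_measure (aux_integrable _ hdm hdM) (aux_integrable _ hdm hdM)] at hd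
  have hP0 : 0 ≤ ∫ x, |f x - g' x| ∂P := integral_nonneg fun x => abs_nonneg _
  have hQ0 : 0 ≤ ∫ x, |f x - g' x| ∂Q := integral_nonneg fun x => abs_nonneg _
  have h1 : ∫ x, f x ∂Q ≤ ∫ x, g' x ∂Q + ∫ x, |f x - g' x| ∂Q := by
    rw [← integral_add (aux_integrable _ hg'm hg'M) (aux_integrable _ hdm hdM)]
    refine integral_mono (aux_integrable _ hf hM)
      ((aux_integrable _ hg'm hg'M).add (aux_integrable _ hdm hdM)) fun x => ?_
    have := le_abs_self (f x - g' x)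
    simp only
    linarith
  have h2 : ∫ x, Real.exp (g' x) ∂P ≤ ∫ x, Real.exp (f x) ∂P
      + Real.exp M * ∫ x, |f x - g' x| ∂P := by
    rw [← integral_const_mul, ← integral_add (aux_integrable_exp _ hf hM)
      ((aux_integrable _ hdm hdM).const_mul _)]
    refine integral_mono (aux_integrable_exp _ hg'm hg'M)
      ((aux_integrable_exp _ hf hM).add ((aux_integrable _ hdm hdM).const_mul _)) fun x => ?_
    exact aux_exp ((le_abs_self _).trans (hg'M x)) hM0
  have h3 := H g'
  rw [le_div_iff₀ (by positivity)] at hd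
  nlinarith

lemma aux_ac {X : Type*} [TopologicalSpace X] [PolishSpace X]
    [MeasurableSpace X] [BorelSpace X] (P Q : Measure X) [IsProbabilityMeasure P]
    [IsProbabilityMeasure Q] (C : ℝ)
    (H : ∀ f : X →ᵇ ℝ, ∫ x, f x ∂Q - (∫ x, Real.exp (f x) ∂P - 1) ≤ C) : Q ≪ P := by
  refine Measure.AbsolutelyContinuous.mk fun s hs hPs => ?_
  have key : ∀ n : ℕ, (n : ℝ) * Q.real s ≤ C := by
    intro n
    have h := aux_meas P Q C H (s.indicator fun _ => (n : ℝ)) (measurable_const.indicator hs) n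
      (by
        intro x
        by_cases hx : x ∈ s <;> simp [hx]) (by positivity)
    have h1 : ∫ x, Real.exp (s.indicator (fun _ => (n : ℝ)) x) ∂P = 1 := by
      have : (fun x => Real.exp (s.indicator (fun _ => (n : ℝ)) x)) =ᵐ[P] fun _ => 1 := by
        have : ∀ᵐ x ∂P, x ∉ s := measure_eq_zero_iff_ae_notMem.1 hPs
        filter_upwards [this] with x hx
        simp [hx]
      rw [integral_congr_ae this]
      simp
    rw [h1, integral_indicator_const _ hs, smul_eq_mul] at h
    linarith
  by_contra hne
  have hpos : 0 < Q.real s := by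
    rw [measureReal_def]
    exact ENNReal.toReal_pos hne (measure_ne_top _ _)
  obtain ⟨n, hn⟩ := exists_nat_gt (C / Q.real s)
  rw [div_lt_iff₀ hpos] at hn
  linarith [key n]

/-- clamp -/
noncomputable def cl (n : ℕ) (x : ℝ) : ℝ := max (Real.exp (-n)) (min x (Real.exp n))

lemma cl_pos (n : ℕ) (x : ℝ) : 0 < cl n x := lt_max_of_lt_left (Real.exp_pos _)

lemma cl_le (n : ℕ) (x : ℝ) : cl n x ≤ Real.exp n :=
  max_le (Real.exp_le_exp.2 (by have : (0:ℝ) ≤ n := by positivity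
                                linarith)) (min_le_right _ _)

lemma cl_log (n : ℕ) (x : ℝ) : |Real.log (cl n x)| ≤ n := by
  rw [abs_le]
  constructor
  · rw [Real.le_log_iff_exp_le (cl_pos n x)]
    exact le_max_left _ _
  · rw [Real.log_le_iff_le_exp (cl_pos n x)]
    exact cl_le n x

lemma cl_meas (n : ℕ) : Measurable (cl n) := by unfold cl; fun_prop

lemma cl_eq_or (n : ℕ) (x : ℝ) : (cl n x ≤ x ∧ 1 ≤ cl n x) ∨ (x ≤ cl n x ∧ cl n x ≤ 1) ∨
    cl n x = x := by
  have h1 : Real.exp (-n) ≤ 1 := Real.exp_le_one_iff.2 (by simp)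
  have h2 : 1 ≤ Real.exp n := Real.one_le_exp (by positivity)
  unfold cl
  rcases max_cases (Real.exp (-n)) (min x (Real.exp n)) with h | h <;>
    rcases min_cases x (Real.exp n) with h' | h'
  · right; left; constructor <;> linarith
  · left; constructor <;> linarith
  · right; right; linarith
  · left; constructor <;> linarith

lemma phi_nonneg (n : ℕ) (x : ℝ) : 0 ≤ x * Real.log (cl n x) + (1 - cl n x) := by
  have h0 := InformationTheory.klFun_nonneg (cl_pos n x).le
  rw [InformationTheory.klFun_apply] at h0
  rcases cl_eq_or n x with h | h | h
  · nlinarith [Real.log_nonneg h.2]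
  · nlinarith [Real.log_nonpos (cl_pos n x).le h.2]
  · rw [h] at h0 ⊢; linarith

lemma cl_tendsto {x : ℝ} (hx : 0 ≤ x) :
    Filter.Tendsto (fun n => cl n x) Filter.atTop (nhds x) := by
  have h1 : Filter.Tendsto (fun n : ℕ => Real.exp (-(n:ℝ))) Filter.atTop (nhds 0) :=
    Real.tendsto_exp_neg_atTop_nhds_zero.comp tendsto_natCast_atTop_atTop
  have h2 : Filter.Tendsto (fun n : ℕ => min x (Real.exp n)) Filter.atTop (nhds x) := by
    refine tendsto_const_nhds.congr' ?_
    have : Filter.Tendsto (fun n : ℕ => Real.exp n) Filter.atTop Filter.atTop :=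
      Real.tendsto_exp_atTop.comp tendsto_natCast_atTop_atTop
    filter_upwards [this.eventually_ge_atTop x] with n hn
    rw [min_eq_left hn]
  have := h1.max h2
  rwa [max_eq_right hx] at this

lemma phi_tendsto {x : ℝ} (hx : 0 ≤ x) :
    Filter.Tendsto (fun n => x * Real.log (cl n x) + (1 - cl n x)) Filter.atTop
      (nhds (InformationTheory.klFun x)) := by
  have h := cl_tendsto hx
  rw [InformationTheory.klFun_apply, add_sub_assoc]
  refine Filter.Tendsto.add ?_ (h.const_sub 1)
  rcases hx.eq_or_lt with rfl | hx
  · simp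
  · exact (h.log hx.ne').const_mul x

lemma aux_kl {X : Type*} [TopologicalSpace X] [PolishSpace X]
    [MeasurableSpace X] [BorelSpace X] (P Q : Measure X) [IsProbabilityMeasure P]
    [IsProbabilityMeasure Q] (C : ℝ)
    (H : ∀ f : X →ᵇ ℝ, ∫ x, f x ∂Q - (∫ x, Real.exp (f x) ∂P - 1) ≤ C) :
    InformationTheory.klDiv Q P ≤ ENNReal.ofReal C := by
  have hac := aux_ac P Q C H
  rw [InformationTheory.klDiv_eq_lintegral_klFun_of_ac hac]
  let g : X → ℝ := fun x => (Q.rnDeriv P x).toReal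
  have hgm : Measurable g := (Measure.measurable_rnDeriv Q P).ennreal_toReal
  let φ : ℕ → X → ℝ := fun n x => g x * Real.log (cl n (g x)) + (1 - cl n (g x))
  have hcm : ∀ n, Measurable (fun x => cl n (g x)) := fun n => (cl_meas n).comp hgm
  have hlm : ∀ n, Measurable (fun x => Real.log (cl n (g x))) := fun n => (hcm n).log
  have hφm : ∀ n, Measurable (φ n) := fun n =>
    (hgm.mul (hlm n)).add ((hcm n).const_sub 1)
  have hb : ∀ n, ∫⁻ x, ENNReal.ofReal (φ n x) ∂P ≤ ENNReal.ofReal C := by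
    intro n
    have h := aux_meas P Q C H _ (hlm n) n (fun x => cl_log n _) (by positivity)
    have hi1 : Integrable (fun x => g x * Real.log (cl n (g x))) P :=
      (integrable_rnDeriv_smul_iff hac).2 (aux_integrable Q (hlm n) (fun x => cl_log n _))
    have hi2 : Integrable (fun x => cl n (g x)) P :=
      aux_integrable P (hcm n) (M := Real.exp n) fun x => by
        rw [abs_of_pos (cl_pos _ _)]; exact cl_le _ _
    have hi : Integrable (φ n) P := hi1.add ((integrable_const 1).sub hi2)
    rw [← ofReal_integral_eq_lintegral_ofReal hi
      (Filter.Eventually.of_forall fun x => phi_nonneg n _)]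
    apply ENNReal.ofReal_le_ofReal
    have e1 : ∫ x, φ n x ∂P = ∫ x, g x * Real.log (cl n (g x)) ∂P
        + ∫ x, (1 - cl n (g x)) ∂P := integral_add hi1 ((integrable_const 1).sub hi2)
    have e2 : ∫ x, g x * Real.log (cl n (g x)) ∂P = ∫ x, Real.log (cl n (g x)) ∂Q :=
      integral_rnDeriv_smul (f := fun x => Real.log (cl n (g x))) hac
    have e3 : ∫ x, (1 - cl n (g x)) ∂P = 1 - ∫ x, cl n (g x) ∂P := by
      rw [integral_sub (integrable_const 1) hi2]; simp
    simp only [Real.exp_log (cl_pos _ _)] at h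
    rw [e1, e2, e3]
    linarith
  calc ∫⁻ x, ENNReal.ofReal (InformationTheory.klFun (g x)) ∂P
      = ∫⁻ x, Filter.liminf (fun n => ENNReal.ofReal (φ n x)) Filter.atTop ∂P := by
        congr 1
        ext x
        exact (((ENNReal.continuous_ofReal.tendsto _).comp
          (phi_tendsto ENNReal.toReal_nonneg)).liminf_eq).symm
    _ ≤ Filter.liminf (fun n => ∫⁻ x, ENNReal.ofReal (φ n x) ∂P) Filter.atTop :=
        lintegral_liminf_le fun n => (hφm n).ennreal_ofReal
    _ ≤ ENNReal.ofReal C := by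
        refine (Filter.liminf_le_liminf (Filter.Eventually.of_forall hb)).trans ?_
        simp

/-- if the pushforward of `Q` under `π₀` equals `ν`, then
`H(Q|P) ≤ J(Q)` where `P = Σ_{z∈Z} ν(z) P_z`. -/
theorem stmt17 {X : Type*} [TopologicalSpace X] [PolishSpace X]
    [MeasurableSpace X] [BorelSpace X]
    {Z : Type*} [Fintype Z] [TopologicalSpace Z] [DiscreteTopology Z]
    [MeasurableSpace Z] [BorelSpace Z]
    (π₀ : X → Z) (hπ : Continuous π₀)
    (ν : Measure Z) [IsProbabilityMeasure ν]
    (P : Z → Measure X) [∀ z, IsProbabilityMeasure (P z)]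
    (hP : ∀ z : Z, P z {x | π₀ x = z} = 1)
    (Q : Measure X) [IsProbabilityMeasure Q]
    (hQ : Q.map π₀ = ν) :
    relEnt Q (∑ z : Z, ν {z} • P z) ≤ Jfun ν P Q := by
  classical
  have hν : ∑ z : Z, ν {z} = 1 := by
    rw [← measure_univ (μ := ν), ← Finset.coe_univ, ← sum_measure_singleton]
  have hprob : IsProbabilityMeasure (∑ z : Z, ν {z} • P z) := by
    constructor
    simp [Measure.finsetSum_apply, hν]
  have hkl : relEnt Q (∑ z : Z, ν {z} • P z)
      = InformationTheory.klDiv Q (∑ z : Z, ν {z} • P z) := by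
    unfold relEnt
    split_ifs with h
    · rw [InformationTheory.klDiv_of_ac_of_integrable h.1 h.2]
      simp
    · rw [eq_comm, InformationTheory.klDiv_eq_top_iff]
      tauto
  rw [hkl]
  by_cases hJ : Jfun ν P Q = ⊤
  · rw [hJ]; exact le_top
  rw [← ENNReal.ofReal_toReal hJ]
  apply aux_kl
  intro f
  have h1 : ∫ x, f x ∂Q - ∑ z : Z, (ν {z}).toReal * Real.log (∫ x, Real.exp (f x) ∂(P z))
      ≤ (Jfun ν P Q).toReal := by
    rw [← ENNReal.ofReal_le_iff_le_toReal hJ]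
    exact le_iSup (fun f : X →ᵇ ℝ => ENNReal.ofReal
      (∫ x, f x ∂Q - ∑ z : Z, (ν {z}).toReal * Real.log (∫ x, Real.exp (f x) ∂(P z)))) f
  have hint : ∀ (μ : Measure X) [IsFiniteMeasure μ], Integrable (fun x => Real.exp (f x)) μ :=
    fun μ _ => aux_integrable_exp μ f.continuous.measurable (M := ‖f‖)
      (fun x => f.norm_coe_le_norm x)
  have h2 : ∫ x, Real.exp (f x) ∂(∑ z : Z, ν {z} • P z)
      = ∑ z : Z, (ν {z}).toReal * ∫ x, Real.exp (f x) ∂(P z) := by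
    rw [integral_finsetSum_measure]
    · simp [integral_smul_measure]
    · intro z _
      exact (hint (P z)).smul_measure (measure_ne_top _ _)
  have hν' : ∑ z : Z, (ν {z}).toReal = 1 := by
    rw [← ENNReal.toReal_sum (fun z _ => measure_ne_top _ _), hν]; simp
  have h3 : ∑ z : Z, (ν {z}).toReal * Real.log (∫ x, Real.exp (f x) ∂(P z))
      ≤ ∑ z : Z, (ν {z}).toReal * (∫ x, Real.exp (f x) ∂(P z)) - ∑ z : Z, (ν {z}).toReal := by
    rw [← Finset.sum_sub_distrib]
    refine Finset.sum_le_sum fun z _ => ?_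
    have hp : 0 < ∫ x, Real.exp (f x) ∂(P z) := integral_exp_pos (hint (P z))
    have := Real.log_le_sub_one_of_pos hp
    have h0 : 0 ≤ (ν {z}).toReal := ENNReal.toReal_nonneg
    nlinarith
  rw [h2]
  linarith
end
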